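/- arXiv:2401.05387 — 2 statements merged into one kernel-verified Lean document; each statement's English description precedes it below -/
import Mathlib

section
/- Consider the system z''(t)=2z(t)³−w(t)+3z'(t)−2/(1+(w'(t))²)−10t, w''(t)=−z(t)+10w(t)³−e^{−(z'(t))²}−3w'(t)−12t for t∈[0,1], with periodic boundary conditions z(0)=z(1), z'(0)=z'(1), w(0)=w(1), w'(0)=w'(1). Then there exists at least one pair (z,w)∈(C²[0,1])² solving this problem and satisfying −8/27+2t²−2t³≤z(t)≤12/5−2t²+2t³ and −1/2+2t−2t²≤w(t)≤2−3t+3t² for all t∈[0,1]. -/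
namespace P11
open MeasureTheory intervalIntegral

/-- Continuation method in a Banach space. -/
lemma continuation {Y : Type*} [NormedAddCommGroup Y] [NormedSpace ℝ Y] [CompleteSpace Y]
    (G : Y → Y) (L C : ℝ) (hC : 0 ≤ C) (hL : 0 ≤ L)
    (hG : ∀ y x, ‖G y - G x‖ ≤ L * ‖y - x‖)
    (hest : ∀ s : ℝ, 0 ≤ s → s ≤ 1 → ∀ y x,
      ‖y - x‖ ≤ C * ‖(y - s • G y) - (x - s • G x)‖) : ∃ y, y = G y := by
  obtain ⟨N, hN⟩ := exists_nat_gt (C * L + 1)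
  have hN0 : (0:ℝ) < N := by nlinarith [mul_nonneg hC hL]
  have key : ∀ n : ℕ, n ≤ N → ∀ g, ∃ y, y - ((n:ℝ) / N) • G y = g := by
    intro n
    induction n with
    | zero => intro _ g; exact ⟨g, by simp⟩
    | succ n ih =>
      intro hn g
      have hs := ih (by omega)
      choose inv hinv using hs
      have hs0 : (0:ℝ) ≤ (n:ℝ) / N := by positivity
      have hs1 : (n:ℝ) / N ≤ 1 := by
        rw [div_le_one hN0]; exact_mod_cast (by omega : n ≤ N)
      have hcon : ContractingWith (Real.toNNReal (C * L / N))
          (fun y => inv (g + (1 / (N:ℝ)) • G y)) := by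
        constructor
        · rw [← NNReal.coe_lt_coe, Real.coe_toNNReal _ (by positivity)]
          rw [NNReal.coe_one, div_lt_one hN0]; linarith
        · apply LipschitzWith.of_dist_le_mul
          intro y x
          rw [Real.coe_toNNReal _ (by positivity), dist_eq_norm, dist_eq_norm]
          have h1 := hest _ hs0 hs1 (inv (g + (1 / (N:ℝ)) • G y)) (inv (g + (1 / (N:ℝ)) • G x))
          rw [hinv, hinv, add_sub_add_left_eq_sub, ← smul_sub, norm_smul] at h1
          have h2 := hG y x
          have h3 : ‖(1 / (N:ℝ))‖ = 1 / N := by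
            rw [Real.norm_eq_abs, abs_of_pos (by positivity)]
          rw [h3] at h1
          calc _ ≤ _ := h1
            _ ≤ C * (1 / N * (L * ‖y - x‖)) := by gcongr
            _ = _ := by ring
      have hfp := hcon.fixedPoint_isFixedPt
      set y := hcon.fixedPoint
      refine ⟨y, ?_⟩
      have h4 : inv (g + (1 / (N:ℝ)) • G y) = y := hfp
      have h5 := hinv (g + (1 / (N:ℝ)) • G y)
      rw [h4] at h5
      have : ((n + 1 : ℕ) : ℝ) / N = (n:ℝ) / N + 1 / N := by push_cast; ring
      rw [this, add_smul, ← sub_sub, h5]; simp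
  obtain ⟨y, hy⟩ := key N le_rfl 0
  rw [div_self hN0.ne', one_smul, sub_eq_zero] at hy
  exact ⟨y, hy⟩

noncomputable def S (k : ℝ) (y : ℝ → ℝ) (t : ℝ) : ℝ :=
  Real.exp (k * t) * (Real.exp k / (1 - Real.exp k) * (∫ s in (0:ℝ)..1, Real.exp (-k * s) * y s)
    + ∫ s in (0:ℝ)..t, Real.exp (-k * s) * y s)

lemma S_deriv (k : ℝ) {y : ℝ → ℝ} (hy : Continuous y) (t : ℝ) :
    HasDerivAt (S k y) (k * S k y t + y t) t := by
  have hc : Continuous fun s => Real.exp (-k * s) * y s := by fun_prop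
  have h1 := (hc.integral_hasStrictDerivAt 0 t).hasDerivAt
  have h2 : HasDerivAt (fun t => Real.exp (k * t)) (Real.exp (k * t) * (k * 1)) t :=
    ((hasDerivAt_id t).const_mul k).exp
  have h3 := h2.mul (h1.const_add
    (Real.exp k / (1 - Real.exp k) * (∫ s in (0:ℝ)..1, Real.exp (-k * s) * y s)))
  have h4 : Real.exp (k * t) * Real.exp (-k * t) = 1 := by
    rw [← Real.exp_add]; simp
  refine h3.congr_deriv ?_
  unfold S
  linear_combination (y t) * h4

lemma S_cont (k : ℝ) {y : ℝ → ℝ} (hy : Continuous y) : Continuous (S k y) :=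
  continuous_iff_continuousAt.2 fun t => (S_deriv k hy t).continuousAt

lemma S_per {k : ℝ} (hk : k ≠ 0) (y : ℝ → ℝ) : S k y 0 = S k y 1 := by
  have : 1 - Real.exp k ≠ 0 := by
    intro h
    exact hk (Real.exp_eq_one_iff k |>.1 (by linarith))
  unfold S
  simp only [mul_zero, Real.exp_zero, integral_same, mul_one, one_mul]
  field_simp
  ring

lemma S_sub (k : ℝ) {y x : ℝ → ℝ} (hy : Continuous y) (hx : Continuous x) (t : ℝ) :
    S k (fun s => y s - x s) t = S k y t - S k x t := by
  unfold S
  have : ∀ a b : ℝ, ∫ s in a..b, Real.exp (-k * s) * (y s - x s) =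
      (∫ s in a..b, Real.exp (-k * s) * y s) - ∫ s in a..b, Real.exp (-k * s) * x s := by
    intro a b
    rw [← integral_sub (Continuous.intervalIntegrable (by fun_prop) _ _)
      (Continuous.intervalIntegrable (by fun_prop) _ _)]
    congr 1; ext s; ring
  rw [this, this]; ring

lemma S_bound (k : ℝ) : ∃ C : ℝ, 0 ≤ C ∧ ∀ y : ℝ → ℝ, Continuous y → ∀ t ∈ Set.Icc (0:ℝ) 1,
    |S k y t| ≤ C * ∫ s in (0:ℝ)..1, |y s| := by
  set E := Real.exp |k|
  set D := |Real.exp k / (1 - Real.exp k)|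
  refine ⟨E * (D * E + E), by positivity, ?_⟩
  intro y hy t ht
  have hI : 0 ≤ ∫ s in (0:ℝ)..1, |y s| :=
    integral_nonneg zero_le_one fun s _ => abs_nonneg _
  have hIntg : ∀ r ∈ Set.Icc (0:ℝ) 1, |∫ s in (0:ℝ)..r, Real.exp (-k * s) * y s| ≤
      E * ∫ s in (0:ℝ)..1, |y s| := by
    intro r hr
    calc _ ≤ ∫ s in (0:ℝ)..r, |Real.exp (-k * s) * y s| := abs_integral_le_integral_abs hr.1
      _ ≤ ∫ s in (0:ℝ)..r, E * |y s| := by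
        apply integral_mono_on hr.1 (Continuous.intervalIntegrable (by fun_prop) _ _)
          (Continuous.intervalIntegrable (by fun_prop) _ _)
        intro s hs
        rw [abs_mul, abs_of_pos (Real.exp_pos _)]
        refine mul_le_mul_of_nonneg_right (Real.exp_le_exp.2 ?_) (abs_nonneg _)
        nlinarith [neg_abs_le k, le_abs_self k, hs.1, hs.2, hr.2, abs_nonneg k]
      _ = E * ∫ s in (0:ℝ)..r, |y s| := by rw [intervalIntegral.integral_const_mul]
      _ ≤ _ := by
        gcongr
        exact integral_mono_interval le_rfl hr.1 hr.2
          (Filter.Eventually.of_forall fun _ => abs_nonneg _)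
          (Continuous.intervalIntegrable (by fun_prop) _ _)
  unfold S
  have h1 := hIntg 1 (by simp)
  have h2 := hIntg t ht
  have h3 : Real.exp (k * t) ≤ E := by
    apply Real.exp_le_exp.2
    nlinarith [neg_abs_le k, le_abs_self k, ht.1, ht.2, abs_nonneg k]
  rw [abs_mul, abs_of_pos (Real.exp_pos _)]
  calc _ ≤ E * (|Real.exp k / (1 - Real.exp k) * (∫ s in (0:ℝ)..1, Real.exp (-k * s) * y s)|
      + |∫ s in (0:ℝ)..t, Real.exp (-k * s) * y s|) := by gcongr; exact abs_add_le _ _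
    _ ≤ E * (D * (E * ∫ s in (0:ℝ)..1, |y s|) + E * ∫ s in (0:ℝ)..1, |y s|) := by
      rw [abs_mul]; gcongr
    _ = _ := by ring

/-- Clamp. -/
noncomputable def cl (a b x : ℝ) : ℝ := max a (min x b)

lemma cl_spec {a b : ℝ} (hab : a ≤ b) (x y : ℝ) :
    a ≤ cl a b x ∧ cl a b x ≤ b ∧ |cl a b x - cl a b y| ≤ |x - y| ∧
    0 ≤ (cl a b x - cl a b y) * (x - y) := by
  have hl : |cl a b x - cl a b y| ≤ |x - y| := by
    unfold cl
    rw [max_comm a, max_comm a]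
    refine (abs_max_sub_max_le_abs (min x b) (min y b) a).trans ?_
    exact (abs_min_sub_min_le_max x b y b).trans (by simp)
  refine ⟨le_max_left _ _, max_le hab (min_le_right _ _), hl, ?_⟩
  rcases le_total x y with h | h
  · have : cl a b x ≤ cl a b y := by unfold cl; gcongr
    nlinarith
  · have : cl a b y ≤ cl a b x := by unfold cl; gcongr
    nlinarith

lemma cl_cont (a b : ℝ) : Continuous (cl a b) := by unfold cl; fun_prop

noncomputable def phi (x : ℝ) : ℝ :=
  2 * (cl (11/20) 2 x) ^ 3 + 9/5 * (x - cl (11/20) 2 x)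
noncomputable def psi (x : ℝ) : ℝ :=
  10 * (cl (7/20) (6/5) x) ^ 3 + 18/5 * (x - cl (7/20) (6/5) x)

lemma gen_mono {P Q x y m c a : ℝ} (ha : 0 ≤ a) (hP : a ≤ P) (hQ : a ≤ Q) (hm : 0 ≤ m)
    (hc : c ≤ 3 * m * a ^ 2)
    (h : 0 ≤ (P - Q) * (x - y)) :
    c * (x - y) ^ 2 ≤ ((m * P ^ 3 + c * (x - P)) - (m * Q ^ 3 + c * (y - Q))) * (x - y) := by
  have h1 : 3 * a ^ 2 ≤ P ^ 2 + P * Q + Q ^ 2 := by nlinarith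
  have h2 : 0 ≤ m * (P ^ 2 + P * Q + Q ^ 2) - c := by nlinarith
  have h3 := mul_nonneg h h2
  nlinarith

lemma gen_lip {P Q x y m c b : ℝ} (hm : 0 ≤ m) (hP0 : 0 ≤ P) (hQ0 : 0 ≤ Q) (hP : P ≤ b)
    (hQ : Q ≤ b) (hc : 0 ≤ c) (h : |P - Q| ≤ |x - y|) :
    |(m * P ^ 3 + c * (x - P)) - (m * Q ^ 3 + c * (y - Q))| ≤
      (3 * m * b ^ 2 + 2 * c) * |x - y| := by
  have h1 : P ^ 2 + P * Q + Q ^ 2 ≤ 3 * b ^ 2 := by nlinarith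
  have e : (m * P ^ 3 + c * (x - P)) - (m * Q ^ 3 + c * (y - Q)) =
    m * (P ^ 2 + P * Q + Q ^ 2) * (P - Q) + c * (x - y) - c * (P - Q) := by ring
  rw [e]
  have h0 : 0 ≤ P ^ 2 + P * Q + Q ^ 2 := by positivity
  calc _ ≤ |m * (P ^ 2 + P * Q + Q ^ 2) * (P - Q)| + |c * (x - y)| + |c * (P - Q)| :=
        (abs_sub _ _).trans (by gcongr; exact abs_add_le _ _)
    _ = m * (P ^ 2 + P * Q + Q ^ 2) * |P - Q| + c * |x - y| + c * |P - Q| := by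
        rw [abs_mul, abs_mul c, abs_mul c, abs_of_nonneg hc, abs_of_nonneg (mul_nonneg hm h0)]
    _ ≤ m * (3 * b ^ 2) * |x - y| + c * |x - y| + c * |x - y| := by gcongr
    _ = _ := by ring

lemma phi_mono (x y : ℝ) : 9/5 * (x - y) ^ 2 ≤ (phi x - phi y) * (x - y) := by
  have h1 := cl_spec (a := 11/20) (b := 2) (by norm_num) x y
  have h2 := cl_spec (a := 11/20) (b := 2) (by norm_num) y x
  exact gen_mono (a := 11/20) (by norm_num) h1.1 h2.1 (by norm_num) (by norm_num) h1.2.2.2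
lemma psi_mono (x y : ℝ) : 18/5 * (x - y) ^ 2 ≤ (psi x - psi y) * (x - y) := by
  have h1 := cl_spec (a := 7/20) (b := 6/5) (by norm_num) x y
  have h2 := cl_spec (a := 7/20) (b := 6/5) (by norm_num) y x
  exact gen_mono (a := 7/20) (by norm_num) h1.1 h2.1 (by norm_num) (by norm_num) h1.2.2.2
lemma phi_lip (x y : ℝ) : |phi x - phi y| ≤ 60 * |x - y| := by
  have h1 := cl_spec (a := 11/20) (b := 2) (by norm_num) x y
  have h2 := cl_spec (a := 11/20) (b := 2) (by norm_num) y x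
  refine (gen_lip (b := 2) (by norm_num) (by linarith) (by linarith) h1.2.1 h2.2.1
    (by norm_num) h1.2.2.1).trans ?_
  gcongr; norm_num
lemma psi_lip (x y : ℝ) : |psi x - psi y| ≤ 60 * |x - y| := by
  have h1 := cl_spec (a := 7/20) (b := 6/5) (by norm_num) x y
  have h2 := cl_spec (a := 7/20) (b := 6/5) (by norm_num) y x
  refine (gen_lip (b := 6/5) (by norm_num) (by linarith) (by linarith) h1.2.1 h2.2.1
    (by norm_num) h1.2.2.1).trans ?_
  gcongr; norm_num
lemma phi_cont : Continuous phi := by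
  have := cl_cont (11/20) 2
  unfold phi; fun_prop
lemma psi_cont : Continuous psi := by
  have := cl_cont (7/20) (6/5)
  unfold psi; fun_prop

lemma p_lip (x y : ℝ) : |2 / (1 + x ^ 2) - 2 / (1 + y ^ 2)| ≤ 2 * |x - y| := by
  have hx : 0 < 1 + x ^ 2 := by positivity
  have hy : 0 < 1 + y ^ 2 := by positivity
  have e : 2 / (1 + x ^ 2) - 2 / (1 + y ^ 2) =
      2 * (-(x + y) / ((1 + x ^ 2) * (1 + y ^ 2))) * (x - y) := by
    field_simp; ring
  have h : |-(x + y) / ((1 + x ^ 2) * (1 + y ^ 2))| ≤ 1 := by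
    rw [abs_div, abs_of_pos (mul_pos hx hy), div_le_one (mul_pos hx hy), abs_le]
    constructor <;> nlinarith [sq_nonneg (x - 1), sq_nonneg (y - 1), sq_nonneg (x + 1),
      sq_nonneg (y + 1), sq_nonneg (x * y)]
  rw [e, abs_mul, abs_mul, abs_two]
  nlinarith [abs_nonneg (x - y)]

lemma e_lip (x y : ℝ) : |Real.exp (-x ^ 2) - Real.exp (-y ^ 2)| ≤ |x - y| := by
  have hd : ∀ s ∈ (Set.univ : Set ℝ), HasDerivWithinAt (fun s : ℝ => Real.exp (-s ^ 2))
      (Real.exp (-s ^ 2) * (-(2 * s))) Set.univ s := by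
    intro s _
    have := ((hasDerivAt_pow 2 s).neg).exp
    refine (this.congr_deriv ?_).hasDerivWithinAt
    simp
  have hb : ∀ s ∈ (Set.univ : Set ℝ), ‖Real.exp (-s ^ 2) * (-(2 * s))‖ ≤ 1 := by
    intro s _
    have h1 : 1 + s ^ 2 ≤ Real.exp (s ^ 2) := by linarith [Real.add_one_le_exp (s ^ 2)]
    rw [norm_mul, Real.norm_eq_abs, Real.norm_eq_abs, abs_of_pos (Real.exp_pos _), Real.exp_neg,
      inv_mul_le_iff₀ (Real.exp_pos _), mul_one, abs_le]
    constructor <;> nlinarith [sq_nonneg (s - 1), sq_nonneg (s + 1)]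
  have := convex_univ.norm_image_sub_le_of_norm_hasDerivWithin_le hd hb
    (Set.mem_univ y) (Set.mem_univ x)
  simpa [Real.norm_eq_abs] using this

/-- Pointwise coercivity. -/
lemma coer {s z z' w w' X Y p e h1 h2 ε : ℝ} (hs0 : 0 ≤ s) (hs1 : s ≤ 1)
    (hX : 9/5 * z ^ 2 ≤ X * z) (hY : 18/5 * w ^ 2 ≤ Y * w)
    (hp : |p| ≤ 2 * |w'|) (he : |e| ≤ |z'|) (hh1 : |h1| ≤ ε) (hh2 : |h2| ≤ ε) :
    1/20 * (z ^ 2 + z' ^ 2 + w ^ 2 + w' ^ 2) - 10 * ε ^ 2 ≤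
      (z' ^ 2 + 4 * z ^ 2 + (h1 + s * (X - 4 * z - w - p)) * z) +
      (w' ^ 2 + 4 * w ^ 2 + (h2 + s * (Y - 4 * w - z - e)) * w) := by
  have hp2 : p ^ 2 ≤ 4 * w' ^ 2 := by
    have := sq_le_sq' (by linarith [abs_nonneg p, abs_nonneg w']) hp
    rw [sq_abs, mul_pow, sq_abs] at this; linarith
  have he2 : e ^ 2 ≤ z' ^ 2 := sq_le_sq.2 he
  have q1 : h1 ^ 2 ≤ ε ^ 2 := sq_le_sq.2 (hh1.trans (le_abs_self _))
  have q2 : h2 ^ 2 ≤ ε ^ 2 := sq_le_sq.2 (hh2.trans (le_abs_self _))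
  have hA : 1/10 * (z ^ 2 + z' ^ 2 + w ^ 2 + w' ^ 2) ≤ z' ^ 2 + w' ^ 2 + X * z + Y * w
      - 2 * z * w - p * z - e * w := by
    nlinarith [sq_nonneg (9/10 * e - w / 2),
      sq_nonneg (p * 9 / 10 - 2 * z), sq_nonneg (p * 9 - 20 * z), sq_nonneg (p * 9 - 5 * w),
      sq_nonneg (e * 9 - 5 * w), sq_nonneg (2 * z - 3 * w), sq_nonneg (z - 2 * w),
      sq_nonneg (9 * p - 20 * z), sq_nonneg (5 * z - 9 * w)]
  have hB : 1/10 * (z ^ 2 + z' ^ 2 + w ^ 2 + w' ^ 2) ≤ z' ^ 2 + w' ^ 2 + 4 * z ^ 2 + 4 * w ^ 2 := by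
    nlinarith [sq_nonneg z, sq_nonneg w, sq_nonneg z', sq_nonneg w', sq_nonneg s]
  have hAs := mul_le_mul_of_nonneg_left hA hs0
  have hBs := mul_le_mul_of_nonneg_left hB (sub_nonneg.2 hs1)
  have r1 : -(1/20 * z ^ 2 + 5 * ε ^ 2) ≤ h1 * z := by nlinarith [sq_nonneg (10 * h1 + z)]
  have r2 : -(1/20 * w ^ 2 + 5 * ε ^ 2) ≤ h2 * w := by nlinarith [sq_nonneg (10 * h2 + w)]
  nlinarith [sq_nonneg z', sq_nonneg w', sq_nonneg s]

lemma energy {z z' d : ℝ → ℝ} {k : ℝ} (hd : Continuous d)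
    (h1 : ∀ t, HasDerivAt z (z' t) t) (h2 : ∀ t, HasDerivAt z' (k * z' t + 4 * z t + d t) t)
    (p1 : z 0 = z 1) (p2 : z' 0 = z' 1) :
    ∫ t in (0:ℝ)..1, (z' t ^ 2 + 4 * z t ^ 2 + d t * z t) = 0 := by
  have c1 : Continuous z := continuous_iff_continuousAt.2 fun t => (h1 t).continuousAt
  have c2 : Continuous z' := continuous_iff_continuousAt.2 fun t => (h2 t).continuousAt
  have h : ∀ t ∈ Set.uIcc (0:ℝ) 1, HasDerivAt (fun t => z t * z' t - k / 2 * (z t * z t))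
      (z' t ^ 2 + 4 * z t ^ 2 + d t * z t) t := by
    intro t _
    refine (((h1 t).mul (h2 t)).sub (((h1 t).mul (h1 t)).const_mul (k/2))).congr_deriv ?_
    ring
  rw [integral_eq_sub_of_hasDerivAt h (Continuous.intervalIntegrable (by fun_prop) _ _)]
  rw [p1, p2]; ring

/-- Extension of a continuous function on `[0,1]` to the line. -/
noncomputable def ext (y : C(Set.Icc (0:ℝ) 1, ℝ)) : ℝ → ℝ := Set.IccExtend zero_le_one y

lemma ext_cont (y : C(Set.Icc (0:ℝ) 1, ℝ)) : Continuous (ext y) := y.continuous.Icc_extend'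

lemma ext_le (y x : C(Set.Icc (0:ℝ) 1, ℝ)) (t : ℝ) : |ext y t - ext x t| ≤ ‖y - x‖ :=
  (y - x).norm_coe_le_norm (Set.projIcc 0 1 zero_le_one t)

lemma ext_of_mem (y : C(Set.Icc (0:ℝ) 1, ℝ)) {t : ℝ} (ht : t ∈ Set.Icc (0:ℝ) 1) :
    ext y t = y ⟨t, ht⟩ := Set.IccExtend_of_mem _ _ ht

noncomputable def U (k l : ℝ) (y : ℝ → ℝ) (t : ℝ) : ℝ := S l (S k y) t
noncomputable def U' (k l : ℝ) (y : ℝ → ℝ) (t : ℝ) : ℝ := l * U k l y t + S k y t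

lemma U_deriv (k l : ℝ) {y : ℝ → ℝ} (hy : Continuous y) (t : ℝ) :
    HasDerivAt (U k l y) (U' k l y t) t := S_deriv l (S_cont k hy) t

lemma U'_deriv (k l : ℝ) {y : ℝ → ℝ} (hy : Continuous y) (t : ℝ) :
    HasDerivAt (U' k l y) ((k + l) * U' k l y t + (-k * l) * U k l y t + y t) t := by
  refine (((U_deriv k l hy t).const_mul l).add (S_deriv k hy t)).congr_deriv ?_
  unfold U'; ring

lemma U_cont (k l : ℝ) {y : ℝ → ℝ} (hy : Continuous y) : Continuous (U k l y) :=
  continuous_iff_continuousAt.2 fun t => (U_deriv k l hy t).continuousAt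
lemma U'_cont (k l : ℝ) {y : ℝ → ℝ} (hy : Continuous y) : Continuous (U' k l y) :=
  continuous_iff_continuousAt.2 fun t => (U'_deriv k l hy t).continuousAt

lemma U_per {k l : ℝ} (hl : l ≠ 0) (y : ℝ → ℝ) : U k l y 0 = U k l y 1 := S_per hl _
lemma U'_per {k l : ℝ} (hk : k ≠ 0) (hl : l ≠ 0) (y : ℝ → ℝ) : U' k l y 0 = U' k l y 1 := by
  unfold U'; rw [U_per hl, S_per hk]

lemma U_diff (k l : ℝ) : ∃ C : ℝ, 0 ≤ C ∧ ∀ y x : ℝ → ℝ, Continuous y → Continuous x →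
    ∀ t ∈ Set.Icc (0:ℝ) 1, |U k l y t - U k l x t| ≤ C * (∫ s in (0:ℝ)..1, |y s - x s|) ∧
      |U' k l y t - U' k l x t| ≤ C * ∫ s in (0:ℝ)..1, |y s - x s| := by
  obtain ⟨C1, h1, hC1⟩ := S_bound k
  obtain ⟨C2, h2, hC2⟩ := S_bound l
  refine ⟨C2 * C1 + (|l| * (C2 * C1) + C1), by positivity, ?_⟩
  intro y x hy hx t ht
  have hI : 0 ≤ ∫ s in (0:ℝ)..1, |y s - x s| :=
    integral_nonneg zero_le_one fun s _ => abs_nonneg _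
  set I := ∫ s in (0:ℝ)..1, |y s - x s|
  have a1 : ∀ t ∈ Set.Icc (0:ℝ) 1, |S k y t - S k x t| ≤ C1 * I := by
    intro t ht
    rw [← S_sub k hy hx]
    exact hC1 _ (by fun_prop) t ht
  have cy := S_cont k hy
  have cx := S_cont k hx
  have a2 : |U k l y t - U k l x t| ≤ C2 * (C1 * I) := by
    unfold U
    rw [← S_sub l cy cx]
    refine (hC2 _ (by fun_prop) t ht).trans ?_
    gcongr
    calc _ ≤ ∫ s in (0:ℝ)..1, C1 * I := by
          apply integral_mono_on zero_le_one (Continuous.intervalIntegrable (by fun_prop) _ _)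
            (Continuous.intervalIntegrable (by fun_prop) _ _)
          exact a1
      _ = _ := by simp
  have a3 : |U' k l y t - U' k l x t| ≤ |l| * (C2 * (C1 * I)) + C1 * I := by
    unfold U'
    have : l * U k l y t + S k y t - (l * U k l x t + S k x t) =
      l * (U k l y t - U k l x t) + (S k y t - S k x t) := by ring
    rw [this]
    refine (abs_add_le _ _).trans ?_
    rw [abs_mul]
    have := a1 t ht
    gcongr
  have n1 : 0 ≤ C2 * C1 * I := by positivity
  have n2 : 0 ≤ C1 * I := by positivity
  have n3 : 0 ≤ |l| * (C2 * C1 * I) := by positivity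
  constructor
  · refine a2.trans ?_; nlinarith
  · refine a3.trans ?_; nlinarith

noncomputable def n1 (t z w w' : ℝ) : ℝ := phi z - 4 * z - w - 2 / (1 + w' ^ 2) - 10 * t
noncomputable def n2 (t z z' w : ℝ) : ℝ := psi w - 4 * w - z - Real.exp (-z' ^ 2) - 12 * t

lemma n1_lip (t z w w' x v v' : ℝ) :
    |n1 t z w w' - n1 t x v v'| ≤ 64 * (|z - x| + |w - v| + |w' - v'|) := by
  have h1 := abs_le.1 (phi_lip z x)
  have h2 := abs_le.1 (p_lip w' v')
  have h3 := abs_le.1 (le_refl |z - x|)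
  have h4 := abs_le.1 (le_refl |w - v|)
  have := abs_nonneg (z - x)
  have := abs_nonneg (w - v)
  have := abs_nonneg (w' - v')
  unfold n1
  rw [abs_le]; constructor <;> linarith

lemma n2_lip (t z z' w x x' v : ℝ) :
    |n2 t z z' w - n2 t x x' v| ≤ 64 * (|z - x| + |z' - x'| + |w - v|) := by
  have h1 := abs_le.1 (psi_lip w v)
  have h2 := abs_le.1 (e_lip z' x')
  have h3 := abs_le.1 (le_refl |z - x|)
  have h4 := abs_le.1 (le_refl |w - v|)
  have := abs_nonneg (z - x)
  have := abs_nonneg (w - v)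
  have := abs_nonneg (z' - x')
  unfold n2
  rw [abs_le]; constructor <;> linarith

abbrev YY := C(Set.Icc (0:ℝ) 1, ℝ) × C(Set.Icc (0:ℝ) 1, ℝ)

noncomputable def Z (y : YY) : ℝ → ℝ := U 4 (-1) (ext y.1)
noncomputable def Z' (y : YY) : ℝ → ℝ := U' 4 (-1) (ext y.1)
noncomputable def W (y : YY) : ℝ → ℝ := U (-4) 1 (ext y.2)
noncomputable def W' (y : YY) : ℝ → ℝ := U' (-4) 1 (ext y.2)

lemma Z_cont (y : YY) : Continuous (Z y) := U_cont _ _ (ext_cont _)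
lemma Z'_cont (y : YY) : Continuous (Z' y) := U'_cont _ _ (ext_cont _)
lemma W_cont (y : YY) : Continuous (W y) := U_cont _ _ (ext_cont _)
lemma W'_cont (y : YY) : Continuous (W' y) := U'_cont _ _ (ext_cont _)

lemma Z_deriv (y : YY) (t : ℝ) : HasDerivAt (Z y) (Z' y t) t := U_deriv _ _ (ext_cont _) t
lemma W_deriv (y : YY) (t : ℝ) : HasDerivAt (W y) (W' y t) t := U_deriv _ _ (ext_cont _) t
lemma Z'_deriv (y : YY) (t : ℝ) : HasDerivAt (Z' y) (3 * Z' y t + 4 * Z y t + ext y.1 t) t :=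
  (U'_deriv _ _ (ext_cont _) t).congr_deriv (by unfold Z Z'; norm_num)
lemma W'_deriv (y : YY) (t : ℝ) : HasDerivAt (W' y) (-3 * W' y t + 4 * W y t + ext y.2 t) t :=
  (U'_deriv _ _ (ext_cont _) t).congr_deriv (by unfold W W'; norm_num)
lemma Z_per (y : YY) : Z y 0 = Z y 1 := U_per (by norm_num) _
lemma W_per (y : YY) : W y 0 = W y 1 := U_per (by norm_num) _
lemma Z'_per (y : YY) : Z' y 0 = Z' y 1 := U'_per (by norm_num) (by norm_num) _
lemma W'_per (y : YY) : W' y 0 = W' y 1 := U'_per (by norm_num) (by norm_num) _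

lemma n1_cont (y : YY) : Continuous fun t : ℝ => n1 t (Z y t) (W y t) (W' y t) := by
  have := phi_cont
  have := Z_cont y
  have := W_cont y
  have := W'_cont y
  have h : ∀ t, 1 + W' y t ^ 2 ≠ 0 := fun t => by positivity
  unfold n1
  fun_prop (disch := assumption)
lemma n2_cont (y : YY) : Continuous fun t : ℝ => n2 t (Z y t) (Z' y t) (W y t) := by
  have := psi_cont
  have := Z_cont y
  have := W_cont y
  have := Z'_cont y
  unfold n2
  fun_prop

noncomputable def G (y : YY) : YY :=
  (⟨fun t => n1 t (Z y t) (W y t) (W' y t), (n1_cont y).comp continuous_subtype_val⟩,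
   ⟨fun t => n2 t (Z y t) (Z' y t) (W y t), (n2_cont y).comp continuous_subtype_val⟩)

lemma ZW_diff : ∃ C : ℝ, 0 ≤ C ∧ ∀ y x : YY, ∀ I : ℝ,
    (∫ s in (0:ℝ)..1, |ext y.1 s - ext x.1 s|) ≤ I →
    (∫ s in (0:ℝ)..1, |ext y.2 s - ext x.2 s|) ≤ I → ∀ t ∈ Set.Icc (0:ℝ) 1,
    |Z y t - Z x t| ≤ C * I ∧ |Z' y t - Z' x t| ≤ C * I ∧
    |W y t - W x t| ≤ C * I ∧ |W' y t - W' x t| ≤ C * I := by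
  obtain ⟨C1, h1, hC1⟩ := U_diff 4 (-1)
  obtain ⟨C2, h2, hC2⟩ := U_diff (-4) 1
  refine ⟨C1 + C2, by positivity, ?_⟩
  intro y x I hI1 hI2 t ht
  have hI : 0 ≤ I := (integral_nonneg zero_le_one fun s _ => abs_nonneg _).trans hI1
  obtain ⟨a1, a2⟩ := hC1 _ _ (ext_cont y.1) (ext_cont x.1) t ht
  obtain ⟨a3, a4⟩ := hC2 _ _ (ext_cont y.2) (ext_cont x.2) t ht
  have b1 : C1 * (∫ s in (0:ℝ)..1, |ext y.1 s - ext x.1 s|) ≤ (C1 + C2) * I := by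
    exact mul_le_mul (by linarith) (by assumption)
      (integral_nonneg zero_le_one fun s _ => abs_nonneg _) (by positivity)
  have b2 : C2 * (∫ s in (0:ℝ)..1, |ext y.2 s - ext x.2 s|) ≤ (C1 + C2) * I := by
    exact mul_le_mul (by linarith) (by assumption)
      (integral_nonneg zero_le_one fun s _ => abs_nonneg _) (by positivity)
  exact ⟨a1.trans b1, a2.trans b1, a3.trans b2, a4.trans b2⟩

lemma YY_norm_le {y : YY} {M : ℝ} (hM : 0 ≤ M) (h1 : ∀ t, |y.1 t| ≤ M) (h2 : ∀ t, |y.2 t| ≤ M) :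
    ‖y‖ ≤ M :=
  norm_prod_le_iff.2 ⟨(ContinuousMap.norm_le _ hM).2 h1, (ContinuousMap.norm_le _ hM).2 h2⟩

lemma ext_int_le (y x : C(Set.Icc (0:ℝ) 1, ℝ)) :
    ∫ s in (0:ℝ)..1, |ext y s - ext x s| ≤ ‖y - x‖ := by
  have := ext_cont y
  have := ext_cont x
  calc _ ≤ ∫ s in (0:ℝ)..1, ‖y - x‖ := by
        apply integral_mono_on zero_le_one (Continuous.intervalIntegrable (by fun_prop) _ _)
          (Continuous.intervalIntegrable (by fun_prop) _ _)
        intro s _; exact ext_le y x s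
    _ = _ := by simp

lemma G_lip : ∃ L : ℝ, 0 ≤ L ∧ ∀ y x, ‖G y - G x‖ ≤ L * ‖y - x‖ := by
  obtain ⟨C, hC, h⟩ := ZW_diff
  refine ⟨64 * (3 * C), by positivity, ?_⟩
  intro y x
  have h' := h y x ‖y - x‖ ((ext_int_le _ _).trans (norm_fst_le (y - x)))
    ((ext_int_le _ _).trans (norm_snd_le (y - x)))
  apply YY_norm_le (by positivity)
  · intro t
    obtain ⟨a1, a2, a3, a4⟩ := h' t t.2
    refine (n1_lip t _ _ _ _ _ _).trans ?_
    linarith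
  · intro t
    obtain ⟨a1, a2, a3, a4⟩ := h' t t.2
    refine (n2_lip t _ _ _ _ _ _).trans ?_
    linarith

lemma abs_le_eps {a ε : ℝ} (hε : 0 < ε) : |a| ≤ a ^ 2 / ε + ε := by
  rw [← sq_abs]
  have : |a| ^ 2 / ε + ε - |a| = ((|a| - ε) ^ 2 + |a| * ε) / ε := by field_simp; ring
  have h2 : 0 ≤ ((|a| - ε) ^ 2 + |a| * ε) / ε := by positivity
  linarith

lemma est : ∃ C : ℝ, 0 ≤ C ∧ ∀ s : ℝ, 0 ≤ s → s ≤ 1 → ∀ y x : YY,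
      ‖y - x‖ ≤ C * ‖(y - s • G y) - (x - s • G x)‖ := by
  obtain ⟨C, hC, hdiff⟩ := ZW_diff
  set K : ℝ := 1 + 64 * 203 with hK
  refine ⟨1 + 64 * (3 * (C * K)), by positivity, ?_⟩
  intro s hs0 hs1 y x
  suffices H : ∀ ε : ℝ, 0 < ε → ‖(y - s • G y) - (x - s • G x)‖ ≤ ε →
      ‖y - x‖ ≤ (1 + 64 * (3 * (C * K))) * ε by
    set h := ‖(y - s • G y) - (x - s • G x)‖ with hh
    have hpos : 0 < 1 + 64 * (3 * (C * K)) := by positivity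
    apply le_of_forall_pos_le_add
    intro e he
    have := H (h + e / (1 + 64 * (3 * (C * K)))) (by positivity)
      (by have : 0 < e / (1 + 64 * (3 * (C * K))) := by positivity
          linarith)
    rw [mul_add, mul_div_cancel₀ _ hpos.ne'] at this
    exact this
  intro ε hε hh
  have hh1 : ∀ t ∈ Set.Icc (0:ℝ) 1, |(ext y.1 t - ext x.1 t) -
      s * (n1 t (Z y t) (W y t) (W' y t) - n1 t (Z x t) (W x t) (W' x t))| ≤ ε := by
    intro t ht
    have := (((y - s • G y) - (x - s • G x)).1.norm_coe_le_norm ⟨t, ht⟩).trans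
      ((norm_fst_le _).trans hh)
    rw [ext_of_mem _ ht, ext_of_mem _ ht]
    refine le_trans (le_of_eq ?_) this
    rw [Real.norm_eq_abs]
    congr 1
    simp [G]; ring
  have hh2 : ∀ t ∈ Set.Icc (0:ℝ) 1, |(ext y.2 t - ext x.2 t) -
      s * (n2 t (Z y t) (Z' y t) (W y t) - n2 t (Z x t) (Z' x t) (W x t))| ≤ ε := by
    intro t ht
    have := (((y - s • G y) - (x - s • G x)).2.norm_coe_le_norm ⟨t, ht⟩).trans
      ((norm_snd_le _).trans hh)
    rw [ext_of_mem _ ht, ext_of_mem _ ht]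
    refine le_trans (le_of_eq ?_) this
    rw [Real.norm_eq_abs]
    congr 1
    simp [G]; ring
  have c1 := ext_cont y.1
  have c2 := ext_cont y.2
  have c3 := ext_cont x.1
  have c4 := ext_cont x.2
  have c5 := Z_cont y
  have c6 := Z_cont x
  have c7 := Z'_cont y
  have c8 := Z'_cont x
  have c9 := W_cont y
  have c10 := W_cont x
  have c11 := W'_cont y
  have c12 := W'_cont x
  have E1 := energy (z := fun t => Z y t - Z x t) (z' := fun t => Z' y t - Z' x t)
    (d := fun t => ext y.1 t - ext x.1 t) (k := 3) (by fun_prop)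
    (fun t => (Z_deriv y t).sub (Z_deriv x t))
    (fun t => ((Z'_deriv y t).sub (Z'_deriv x t)).congr_deriv (by ring))
    (by simp only [Z_per]) (by simp only [Z'_per])
  have E2 := energy (z := fun t => W y t - W x t) (z' := fun t => W' y t - W' x t)
    (d := fun t => ext y.2 t - ext x.2 t) (k := -3) (by fun_prop)
    (fun t => (W_deriv y t).sub (W_deriv x t))
    (fun t => ((W'_deriv y t).sub (W'_deriv x t)).congr_deriv (by ring))
    (by simp only [W_per]) (by simp only [W'_per])
  set q : ℝ → ℝ := fun t => (Z y t - Z x t) ^ 2 + (Z' y t - Z' x t) ^ 2 + (W y t - W x t) ^ 2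
    + (W' y t - W' x t) ^ 2 with hq
  have cq : Continuous q := by fun_prop
  have hIntg : ∀ f : ℝ → ℝ, Continuous f → IntervalIntegrable f volume 0 1 :=
    fun f hf => hf.intervalIntegrable _ _
  have hQ : ∫ t in (0:ℝ)..1, q t ≤ 200 * ε ^ 2 := by
    have h1 : ∫ t in (0:ℝ)..1, (1/20 * q t - 10 * ε ^ 2) ≤ 0 := by
      have E := congrArg₂ (· + ·) E1 E2
      simp only [add_zero] at E
      rw [← intervalIntegral.integral_add (hIntg _ (by fun_prop)) (hIntg _ (by fun_prop))] at E
      refine le_trans ?_ E.le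
      apply integral_mono_on zero_le_one (hIntg _ (by fun_prop)) (hIntg _ (by fun_prop))
      intro t ht
      have := coer hs0 hs1 (phi_mono (Z y t) (Z x t)) (psi_mono (W y t) (W x t))
        (p_lip (W' y t) (W' x t)) (e_lip (Z' y t) (Z' x t)) (hh1 t ht) (hh2 t ht)
      refine this.trans (le_of_eq ?_)
      unfold n1 n2
      ring
    rw [intervalIntegral.integral_sub (hIntg _ (by fun_prop)) (hIntg _ (by fun_prop)),
      intervalIntegral.integral_const_mul] at h1
    simp at h1
    linarith
  have hQe : ∫ t in (0:ℝ)..1, (ε + 64 * (q t / ε + 3 * ε)) ≤ K * ε := by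
    have e1 : ∀ t, ε + 64 * (q t / ε + 3 * ε) = 64 / ε * q t + 193 * ε := by intro t; ring
    simp only [e1]
    rw [intervalIntegral.integral_add (hIntg _ (by fun_prop)) (hIntg _ (by fun_prop)),
      intervalIntegral.integral_const_mul]
    have : 64 / ε * ∫ t in (0:ℝ)..1, q t ≤ 64 / ε * (200 * ε ^ 2) := by gcongr
    have e2 : 64 / ε * (200 * ε ^ 2) = 64 * 200 * ε := by field_simp
    simp only [intervalIntegral.integral_const, sub_zero, one_smul]
    rw [hK]; linarith
  have d1 : ∀ t ∈ Set.Icc (0:ℝ) 1, |ext y.1 t - ext x.1 t| ≤ ε + 64 * (|Z y t - Z x t| +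
      |W y t - W x t| + |W' y t - W' x t|) := by
    intro t ht
    have a1 := abs_le.1 (hh1 t ht)
    have a3 := n1_lip t (Z y t) (W y t) (W' y t) (Z x t) (W x t) (W' x t)
    set N := n1 t (Z y t) (W y t) (W' y t) - n1 t (Z x t) (W x t) (W' x t)
    have a2 : |s * N| ≤ |N| := by
      rw [abs_mul, abs_of_nonneg hs0]; nlinarith [abs_nonneg N]
    have a4 := abs_le.1 (a2.trans a3)
    rw [abs_le]; constructor <;> linarith
  have d2 : ∀ t ∈ Set.Icc (0:ℝ) 1, |ext y.2 t - ext x.2 t| ≤ ε + 64 * (|Z y t - Z x t| +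
      |Z' y t - Z' x t| + |W y t - W x t|) := by
    intro t ht
    have a1 := abs_le.1 (hh2 t ht)
    have a3 := n2_lip t (Z y t) (Z' y t) (W y t) (Z x t) (Z' x t) (W x t)
    set N := n2 t (Z y t) (Z' y t) (W y t) - n2 t (Z x t) (Z' x t) (W x t)
    have a2 : |s * N| ≤ |N| := by
      rw [abs_mul, abs_of_nonneg hs0]; nlinarith [abs_nonneg N]
    have a4 := abs_le.1 (a2.trans a3)
    rw [abs_le]; constructor <;> linarith
  have I1 : ∫ t in (0:ℝ)..1, |ext y.1 t - ext x.1 t| ≤ K * ε := by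
    refine le_trans ?_ hQe
    apply integral_mono_on zero_le_one (hIntg _ (by fun_prop)) (hIntg _ (by fun_prop))
    intro t ht
    refine (d1 t ht).trans ?_
    have b1 := abs_le_eps (a := Z y t - Z x t) hε
    have b2 := abs_le_eps (a := W y t - W x t) hε
    have b3 := abs_le_eps (a := W' y t - W' x t) hε
    have b4 : 0 ≤ (Z' y t - Z' x t) ^ 2 / ε := by positivity
    simp only [hq, add_div]
    linarith
  have I2 : ∫ t in (0:ℝ)..1, |ext y.2 t - ext x.2 t| ≤ K * ε := by
    refine le_trans ?_ hQe
    apply integral_mono_on zero_le_one (hIntg _ (by fun_prop)) (hIntg _ (by fun_prop))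
    intro t ht
    refine (d2 t ht).trans ?_
    have b1 := abs_le_eps (a := Z y t - Z x t) hε
    have b2 := abs_le_eps (a := W y t - W x t) hε
    have b3 := abs_le_eps (a := Z' y t - Z' x t) hε
    have b4 : 0 ≤ (W' y t - W' x t) ^ 2 / ε := by positivity
    simp only [hq, add_div]
    linarith
  have hfin := hdiff y x (K * ε) I1 I2
  apply YY_norm_le (by positivity)
  · intro t
    obtain ⟨a1, a2, a3, a4⟩ := hfin t t.2
    have := d1 t t.2
    rw [ext_of_mem _ t.2, ext_of_mem _ t.2] at this
    refine this.trans ?_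
    linarith
  · intro t
    obtain ⟨a1, a2, a3, a4⟩ := hfin t t.2
    have := d2 t t.2
    rw [ext_of_mem _ t.2, ext_of_mem _ t.2] at this
    refine this.trans ?_
    linarith

lemma fixed : ∃ y : YY, y = G y := by
  obtain ⟨L, hL, h1⟩ := G_lip
  obtain ⟨C, hC, h2⟩ := est
  exact continuation G L C hC hL h1 h2

lemma right_nonneg {f : ℝ → ℝ} {m t u : ℝ} (h : HasDerivAt f m t) (hu : t < u)
    (hf : ∀ r ∈ Set.Ioo t u, f t ≤ f r) : 0 ≤ m := by
  have h1 := (hasDerivWithinAt_iff_tendsto_slope' (s := Set.Ioi t) (by simp)).1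
    h.hasDerivWithinAt
  refine ge_of_tendsto h1 ?_
  filter_upwards [Ioo_mem_nhdsGT hu] with r hr
  rw [slope_def_field]
  exact div_nonneg (by linarith [hf r hr]) (by linarith [hr.1])

lemma left_nonpos {f : ℝ → ℝ} {m t u : ℝ} (h : HasDerivAt f m t) (hu : u < t)
    (hf : ∀ r ∈ Set.Ioo u t, f t ≤ f r) : m ≤ 0 := by
  have h1 := (hasDerivWithinAt_iff_tendsto_slope' (s := Set.Iio t) (by simp)).1
    h.hasDerivWithinAt
  refine le_of_tendsto h1 ?_
  filter_upwards [Ioo_mem_nhdsLT hu] with r hr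
  rw [slope_def_field]
  exact div_nonpos_of_nonneg_of_nonpos (by linarith [hf r hr]) (by linarith [hr.2])

/-- Periodic minimum principle. -/
lemma minp {z z' z'' : ℝ → ℝ} (h1 : ∀ t, HasDerivAt z (z' t) t)
    (h2 : ∀ t, HasDerivAt z' (z'' t) t) (p1 : z 0 = z 1) (p2 : z' 0 = z' 1) :
    ∃ t ∈ Set.Icc (0:ℝ) 1, (∀ r ∈ Set.Icc (0:ℝ) 1, z t ≤ z r) ∧ z' t = 0 ∧ 0 ≤ z'' t := by
  have c1 : Continuous z := continuous_iff_continuousAt.2 fun t => (h1 t).continuousAt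
  obtain ⟨t0, ht0, hmin0⟩ := isCompact_Icc.exists_isMinOn (s := Set.Icc (0:ℝ) 1)
    (by simp) c1.continuousOn
  obtain ⟨t, ht, hmin⟩ : ∃ t ∈ Set.Ico (0:ℝ) 1, ∀ r ∈ Set.Icc (0:ℝ) 1, z t ≤ z r := by
    rcases ht0.2.lt_or_eq with h | h
    · exact ⟨t0, ⟨ht0.1, h⟩, fun r hr => hmin0 hr⟩
    · refine ⟨0, by simp, fun r hr => ?_⟩
      rw [p1, ← h]; exact hmin0 hr
  have hge : 0 ≤ z' t := right_nonneg (h1 t) ht.2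
    fun r hr => hmin r ⟨by linarith [ht.1, hr.1], hr.2.le⟩
  have hle : z' t ≤ 0 := by
    rcases ht.1.eq_or_lt with h | h
    · rw [← h, p2]
      refine left_nonpos (h1 1) zero_lt_one fun r hr => ?_
      rw [← p1, h]; exact hmin r ⟨hr.1.le, hr.2.le⟩
    · exact left_nonpos (h1 t) h fun r hr => hmin r ⟨hr.1.le, by linarith [ht.2, hr.2]⟩
  have h0 : z' t = 0 := le_antisymm hle hge
  refine ⟨t, ⟨ht.1, ht.2.le⟩, hmin, h0, ?_⟩
  by_contra! hneg
  have s1 := (hasDerivWithinAt_iff_tendsto_slope' (s := Set.Ioi t) (by simp)).1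
    (h2 t).hasDerivWithinAt
  have s2 := s1.eventually (gt_mem_nhds hneg)
  obtain ⟨u, hu, hsub⟩ := (mem_nhdsGT_iff_exists_Ioo_subset).1 s2
  have hu' : t < u := hu
  set v := min u 1
  have htv : t < v := lt_min hu' ht.2
  obtain ⟨c, hc, hcs⟩ := exists_hasDerivAt_eq_slope z z' htv c1.continuousOn
    (fun r _ => h1 r)
  have h3 : slope z' t c < 0 := hsub ⟨hc.1, hc.2.trans_le (min_le_left _ _)⟩
  rw [slope_def_field, h0, sub_zero, div_neg_iff] at h3
  have h4 : 0 ≤ z' c := by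
    rw [hcs]
    exact div_nonneg (by linarith [hmin v ⟨by linarith [ht.1], min_le_right _ _⟩]) (by linarith)
  rcases h3 with h3 | h3
  · linarith [hc.1, h3.2]
  · linarith [h3.1]

lemma maxp {z z' z'' : ℝ → ℝ} (h1 : ∀ t, HasDerivAt z (z' t) t)
    (h2 : ∀ t, HasDerivAt z' (z'' t) t) (p1 : z 0 = z 1) (p2 : z' 0 = z' 1) :
    ∃ t ∈ Set.Icc (0:ℝ) 1, (∀ r ∈ Set.Icc (0:ℝ) 1, z r ≤ z t) ∧ z' t = 0 ∧ z'' t ≤ 0 := by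
  obtain ⟨t, ht, a, b, c⟩ := minp (z := fun t => -z t) (z' := fun t => -z' t)
    (z'' := fun t => -z'' t) (fun t => (h1 t).neg) (fun t => (h2 t).neg) (by simp [p1])
    (by simp [p2])
  exact ⟨t, ht, fun r hr => by linarith [a r hr], by linarith, by linarith⟩

lemma phi_low {x : ℝ} (h : x ≤ 11/20) : phi x = 2 * (11/20) ^ 3 + 9/5 * (x - 11/20) := by
  have : cl (11/20) 2 x = 11/20 := by unfold cl; rw [min_eq_left (by linarith), max_eq_left h]
  unfold phi; rw [this]
lemma phi_high {x : ℝ} (h : 2 ≤ x) : phi x = 16 + 9/5 * (x - 2) := by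
  have : cl (11/20) 2 x = 2 := by
    unfold cl; rw [min_eq_right h, max_eq_right (by norm_num)]
  unfold phi; rw [this]; norm_num
lemma phi_mid {x : ℝ} (h : 11/20 ≤ x) (h' : x ≤ 2) : phi x = 2 * x ^ 3 := by
  have : cl (11/20) 2 x = x := by
    unfold cl; rw [min_eq_left h', max_eq_right h]
  unfold phi; rw [this]; ring
lemma psi_low {x : ℝ} (h : x ≤ 7/20) : psi x = 10 * (7/20) ^ 3 + 18/5 * (x - 7/20) := by
  have : cl (7/20) (6/5) x = 7/20 := by
    unfold cl; rw [min_eq_left (by linarith), max_eq_left h]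
  unfold psi; rw [this]
lemma psi_high {x : ℝ} (h : 6/5 ≤ x) : psi x = 10 * (6/5) ^ 3 + 18/5 * (x - 6/5) := by
  have : cl (7/20) (6/5) x = 6/5 := by
    unfold cl; rw [min_eq_right h, max_eq_right (by norm_num)]
  unfold psi; rw [this]
lemma psi_mid {x : ℝ} (h : 7/20 ≤ x) (h' : x ≤ 6/5) : psi x = 10 * x ^ 3 := by
  have : cl (7/20) (6/5) x = x := by
    unfold cl; rw [min_eq_left h', max_eq_right h]
  unfold psi; rw [this]; ring

lemma phi_le {x y : ℝ} (h : x ≤ y) : phi x ≤ phi y := by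
  rcases h.eq_or_lt with h | h
  · rw [h]
  · nlinarith [phi_mono y x, sq_nonneg (y - x)]
lemma psi_le {x y : ℝ} (h : x ≤ y) : psi x ≤ psi y := by
  rcases h.eq_or_lt with h | h
  · rw [h]
  · nlinarith [psi_mono y x, sq_nonneg (y - x)]

lemma low_bd {m n : ℝ} (h1 : n ≤ phi m) (h2 : m ≤ psi n) : 11/20 ≤ m ∧ 7/20 ≤ n := by
  rcases le_total (11/20) m with hm | hm <;> rcases le_total (7/20) n with hn | hn
  · exact ⟨hm, hn⟩
  · have := psi_low hn
    refine ⟨hm, ?_⟩; linarith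
  · have := phi_low hm
    refine ⟨?_, hn⟩; linarith
  · have := phi_low hm
    have := psi_low hn
    constructor <;> linarith

lemma high_bd {m n : ℝ} (h1 : phi m ≤ n + 12) (h2 : psi n ≤ m + 13) : m ≤ 2 ∧ n ≤ 6/5 := by
  rcases le_total m 2 with hm | hm <;> rcases le_total n (6/5) with hn | hn
  · exact ⟨hm, hn⟩
  · have := psi_high hn
    refine ⟨hm, ?_⟩; linarith
  · have := phi_high hm
    refine ⟨?_, hn⟩; linarith
  · have := phi_high hm
    have := psi_high hn
    constructor <;> linarith

lemma cd2 {z z' z'' : ℝ → ℝ} (h1 : ∀ t, HasDerivAt z (z' t) t)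
    (h2 : ∀ t, HasDerivAt z' (z'' t) t) (hc : Continuous z'') :
    ContDiff ℝ 2 z ∧ deriv z = z' ∧ deriv z' = z'' := by
  have e1 : deriv z = z' := funext fun t => (h1 t).deriv
  have e2 : deriv z' = z'' := funext fun t => (h2 t).deriv
  refine ⟨?_, e1, e2⟩
  have h3 : ContDiff ℝ 1 z' := by
    rw [contDiff_one_iff_deriv, e2]
    exact ⟨fun t => (h2 t).differentiableAt, hc⟩
  have : (2 : WithTop ℕ∞) = 1 + 1 := by norm_num
  rw [this, contDiff_succ_iff_deriv, e1]
  exact ⟨fun t => (h1 t).differentiableAt, by simp, h3⟩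

end P11


/-- The example system on `[0,1]` with periodic boundary conditions has at
least one solution `(z, w) ∈ (C²[0,1])²`, localized between the shifted lower
and upper solutions. -/
theorem stmt_11 :
    ∃ z w : ℝ → ℝ, ContDiff ℝ 2 z ∧ ContDiff ℝ 2 w ∧
      (∀ t ∈ Set.Icc (0:ℝ) 1,
        deriv (deriv z) t =
          2 * (z t) ^ 3 - w t + 3 * deriv z t - 2 / (1 + (deriv w t) ^ 2) - 10 * t) ∧
      (∀ t ∈ Set.Icc (0:ℝ) 1,
        deriv (deriv w) t =
          -(z t) + 10 * (w t) ^ 3 - Real.exp (-(deriv z t) ^ 2) - 3 * deriv w t - 12 * t) ∧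
      z 0 = z 1 ∧ deriv z 0 = deriv z 1 ∧ w 0 = w 1 ∧ deriv w 0 = deriv w 1 ∧
      (∀ t ∈ Set.Icc (0:ℝ) 1,
        -8 / 27 + 2 * t ^ 2 - 2 * t ^ 3 ≤ z t ∧ z t ≤ 12 / 5 - 2 * t ^ 2 + 2 * t ^ 3 ∧
        -1 / 2 + 2 * t - 2 * t ^ 2 ≤ w t ∧ w t ≤ 2 - 3 * t + 3 * t ^ 2) := by

  obtain ⟨y, hy⟩ := P11.fixed
  have hz1 := P11.Z_deriv y
  have hz2 := P11.Z'_deriv y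
  have hw1 := P11.W_deriv y
  have hw2 := P11.W'_deriv y
  have cz := P11.Z_cont y
  have cz' := P11.Z'_cont y
  have cw := P11.W_cont y
  have cw' := P11.W'_cont y
  have ce1 := P11.ext_cont y.1
  have ce2 := P11.ext_cont y.2
  have pz := P11.Z_per y
  have pz' := P11.Z'_per y
  have pw := P11.W_per y
  have pw' := P11.W'_per y
  have ez : ∀ t ∈ Set.Icc (0:ℝ) 1, P11.ext y.1 t =
      P11.n1 t (P11.Z y t) (P11.W y t) (P11.W' y t) := by
    intro t ht
    rw [P11.ext_of_mem _ ht]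
    exact congrArg (fun v : P11.YY => v.1 ⟨t, ht⟩) hy
  have ew : ∀ t ∈ Set.Icc (0:ℝ) 1, P11.ext y.2 t =
      P11.n2 t (P11.Z y t) (P11.Z' y t) (P11.W y t) := by
    intro t ht
    rw [P11.ext_of_mem _ ht]
    exact congrArg (fun v : P11.YY => v.2 ⟨t, ht⟩) hy
  obtain ⟨dz, dz1, dz2⟩ := P11.cd2 hz1 hz2 (by fun_prop)
  obtain ⟨dw, dw1, dw2⟩ := P11.cd2 hw1 hw2 (by fun_prop)
  obtain ⟨t1, ht1, m1, f1, g1⟩ := P11.minp hz1 hz2 pz pz'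
  obtain ⟨t2, ht2, m2, f2, g2⟩ := P11.minp hw1 hw2 pw pw'
  obtain ⟨t3, ht3, m3, f3, g3⟩ := P11.maxp hz1 hz2 pz pz'
  obtain ⟨t4, ht4, m4, f4, g4⟩ := P11.maxp hw1 hw2 pw pw'
  have ppos : ∀ a : ℝ, 0 ≤ 2 / (1 + a ^ 2) := fun a => by positivity
  have ple : ∀ a : ℝ, 2 / (1 + a ^ 2) ≤ 2 := fun a => by
    rw [div_le_iff₀ (by positivity)]; nlinarith [sq_nonneg a]
  have epos : ∀ a : ℝ, 0 ≤ Real.exp (-a ^ 2) := fun a => (Real.exp_pos _).le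
  have ele : ∀ a : ℝ, Real.exp (-a ^ 2) ≤ 1 := fun a =>
    Real.exp_le_one_iff.2 (by linarith [sq_nonneg a])
  rw [ez _ ht1, f1] at g1
  rw [ew _ ht2, f2] at g2
  rw [ez _ ht3, f3] at g3
  rw [ew _ ht4, f4] at g4
  simp only [P11.n1] at g1 g3
  simp only [P11.n2] at g2 g4
  obtain ⟨lz, lw⟩ := P11.low_bd (m := P11.Z y t1) (n := P11.W y t2)
    (by linarith [ppos (P11.W' y t1), ht1.1, m2 t1 ht1])
    (by linarith [epos (P11.Z' y t2), ht2.1, m1 t2 ht2])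
  obtain ⟨uz, uw⟩ := P11.high_bd (m := P11.Z y t3) (n := P11.W y t4)
    (by linarith [ple (P11.W' y t3), ht3.2, m4 t3 ht3])
    (by linarith [ele (P11.Z' y t4), ht4.2, m3 t4 ht4])
  refine ⟨P11.Z y, P11.W y, dz, dw, ?_, ?_, pz, ?_, pw, ?_, ?_⟩
  · intro t ht
    rw [dz1, dz2, dw1]
    simp only [ez t ht, P11.n1]
    rw [P11.phi_mid (lz.trans (m1 t ht)) ((m3 t ht).trans uz)]
    ring
  · intro t ht
    rw [dw1, dw2, dz1]
    simp only [ew t ht, P11.n2]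
    rw [P11.psi_mid (lw.trans (m2 t ht)) ((m4 t ht).trans uw)]
    ring
  · rw [dz1]; exact pz'
  · rw [dw1]; exact pw'
  · intro t ht
    have a1 := lz.trans (m1 t ht)
    have a2 := (m3 t ht).trans uz
    have a3 := lw.trans (m2 t ht)
    have a4 := (m4 t ht).trans uw
    have b1 := mul_nonneg ht.1 (sub_nonneg.2 ht.2)
    have b2 : t ^ 2 - t ^ 3 ≤ 1/4 * t := by nlinarith [mul_nonneg ht.1 (sq_nonneg (t - 1/2))]
    have b3 : t ^ 2 - t ^ 3 ≤ 4/27 := by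
      nlinarith [mul_nonneg (by linarith [ht.1] : 0 ≤ t + 1/3) (sq_nonneg (t - 2/3))]
    refine ⟨by linarith, by linarith, ?_, ?_⟩ <;> nlinarith [sq_nonneg (t - 1/2)]
end

section
/- Consider the coupled forced Van der Pol system z''(t)=z'(t)(1−0.5z(t)²)−z(t)+6·tanh(3z(t)−2w(t))+cos t, w''(t)=w'(t)(1−0.5w(t)²)−w(t)+8·arctan(2w(t)−z(t))−cos t for t∈[0,1], with periodic boundary conditions z(0)=z(1), z'(0)=z'(1), w(0)=w(1), w'(0)=w'(1). Then there exists at least one pair (z,w)∈(C²[0,1])² solving this problem and satisfying −5/4+t−t²≤z(t)≤2−t²/2+t³/2 and −1+t−t²≤w(t)≤2−t²+t³ for all t∈[0,1]; in particular this solution is non-trivial (not a pair of constant functions). -/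
open Set Filter Topology

lemma vdp_right_gt {f : ℝ → ℝ} {f' x : ℝ} (h : HasDerivAt f f' x) (hp : 0 < f') :
    ∀ᶠ y in 𝓝[>] x, f x < f y := by
  have h1 := (hasDerivAt_iff_tendsto_slope.1 h).eventually (lt_mem_nhds hp)
  have h2 : ∀ᶠ y in 𝓝[>] x, 0 < slope f x y :=
    h1.filter_mono (nhdsWithin_mono _ (fun y hy => ne_of_gt hy))
  filter_upwards [h2, self_mem_nhdsWithin] with y hy hxy
  rw [slope_def_field] at hy
  have hxy' : 0 < y - x := sub_pos.2 hxy
  have := (div_pos_iff_of_pos_right hxy').1 hy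
  linarith

/-- A maximum on `[0,1]` of a function with equal end values is attained in `[0,1)`. -/
lemma vdp_exists_max {f : ℝ → ℝ} (hc : Continuous f) (h01 : f 0 = f 1) :
    ∃ t ∈ Ico (0:ℝ) 1, ∀ s ∈ Icc (0:ℝ) 1, f s ≤ f t := by
  obtain ⟨t, ht, hm⟩ := isCompact_Icc.exists_isMaxOn (nonempty_Icc.2 zero_le_one)
    (hc.continuousOn (s := Icc (0:ℝ) 1))
  rcases lt_or_eq_of_le ht.2 with h | h
  · exact ⟨t, ⟨ht.1, h⟩, fun s hs => hm hs⟩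
  · refine ⟨0, by simp, fun s hs => ?_⟩
    have := hm hs
    simp only [mem_ofPred_eq] at this
    rw [h01]; rw [h] at this; exact this

lemma vdp_ev_Ioo {t : ℝ} (ht : t ∈ Ico (0:ℝ) 1) : ∀ᶠ y in 𝓝[>] t, y ∈ Ioo t 1 :=
  Ioo_mem_nhdsGT ht.2

lemma vdp_max1 {f f' : ℝ → ℝ} {ε : ℝ} (hf : ∀ t, HasDerivAt f (f' t) t) (h01 : f 0 = f 1)
    (h : ∀ t ∈ Icc (0:ℝ) 1, ε < f t → 0 < f' t) : ∀ t ∈ Icc (0:ℝ) 1, f t ≤ ε := by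
  have hc : Continuous f := continuous_iff_continuousAt.2 fun t => (hf t).continuousAt
  obtain ⟨t, ht, hm⟩ := vdp_exists_max hc h01
  intro s hs
  by_contra hcon
  push Not at hcon
  have h1 : 0 < f' t := h t ⟨ht.1, ht.2.le⟩ (hcon.trans_le (hm s hs))
  obtain ⟨y, hy1, hy2⟩ := ((vdp_right_gt (hf t) h1).and (vdp_ev_Ioo ht)).exists
  have := hm y ⟨ht.1.trans hy2.1.le, hy2.2.le⟩
  linarith

lemma vdp_max1' {f f' : ℝ → ℝ} {ε : ℝ} (hf : ∀ t, HasDerivAt f (f' t) t) (h01 : f 0 = f 1)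
    (h : ∀ t ∈ Icc (0:ℝ) 1, ε < f t → f' t < 0) : ∀ t ∈ Icc (0:ℝ) 1, f t ≤ ε := by
  intro t ht
  have := vdp_max1 (f := fun t => f (1 - t)) (f' := fun t => - f' (1 - t)) (ε := ε)
    (fun t => by
      have h1 : HasDerivAt (fun t : ℝ => 1 - t) (-1) t := by
        simpa using (hasDerivAt_id t).const_sub 1
      have := (hf (1 - t)).comp t h1
      simpa [Function.comp_def] using this) (by simp [h01])
    (fun t ht h1 => by
      have := h (1 - t) ⟨by linarith [ht.2], by linarith [ht.1]⟩ h1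
      linarith) (1 - t) ⟨by linarith [ht.2], by linarith [ht.1]⟩
  simpa using this

/-- Second order maximum principle with periodic type boundary conditions. -/
lemma vdp_max2 {d d1 d2 : ℝ → ℝ} {ε : ℝ} (hd : ∀ t, HasDerivAt d (d1 t) t)
    (hd1 : ∀ t, HasDerivAt d1 (d2 t) t) (h01 : d 0 = d 1) (h01' : d1 1 ≤ d1 0)
    (h : ∀ t ∈ Icc (0:ℝ) 1, ε < d t → d1 t = 0 → 0 < d2 t) :
    ∀ t ∈ Icc (0:ℝ) 1, d t ≤ ε := by
  have hc : Continuous d := continuous_iff_continuousAt.2 fun t => (hd t).continuousAt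
  obtain ⟨t, ht, hm⟩ := vdp_exists_max hc h01
  intro s hs
  by_contra hcon
  push Not at hcon
  have hle : d1 t ≤ 0 := by
    by_contra h1
    push Not at h1
    obtain ⟨y, hy1, hy2⟩ := ((vdp_right_gt (hd t) h1).and (vdp_ev_Ioo ht)).exists
    have := hm y ⟨ht.1.trans hy2.1.le, hy2.2.le⟩
    linarith
  have hge : 0 ≤ d1 t := by
    rcases eq_or_lt_of_le ht.1 with h0 | h0
    · subst h0
      refine le_trans ?_ h01'
      by_contra h1
      push Not at h1
      have hr : HasDerivAt (fun t => d (1 - t)) (- d1 1) 0 := by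
        have h1 : HasDerivAt (fun t : ℝ => 1 - t) (-1) 0 := by
          simpa using (hasDerivAt_id (0:ℝ)).const_sub 1
        have h2 : HasDerivAt d (d1 1) (1 - 0) := by simpa using hd 1
        have := h2.comp (0:ℝ) h1
        simpa [Function.comp_def] using this
      obtain ⟨y, hy1, hy2⟩ := ((vdp_right_gt hr (by linarith)).and (vdp_ev_Ioo ht)).exists
      have := hm (1 - y) ⟨by linarith [hy2.2], by linarith [hy2.1]⟩
      simp at hy1
      linarith
    · have hloc : IsLocalMax d t := by
        filter_upwards [Ioo_mem_nhds h0 ht.2] with y hy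
        exact hm y ⟨hy.1.le, hy.2.le⟩
      exact (hloc.hasDerivAt_eq_zero (hd t)).ge
  have h0 : d1 t = 0 := le_antisymm hle hge
  have hpos := h t ⟨ht.1, ht.2.le⟩ (hcon.trans_le (hm s hs)) h0
  have h3 := vdp_right_gt (hd1 t) hpos
  rw [h0] at h3
  obtain ⟨b, hb, hb2⟩ := (mem_nhdsGT_iff_exists_Ioo_subset' (show t < 1 from ht.2)).1 h3
  set c := min ((t + b) / 2) ((t+1)/2) with hcdef
  have hb' : t < b := hb
  have htc : t < c := lt_min (by linarith) (by linarith [ht.2])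
  have hcb : c < b := (min_le_left _ _).trans_lt (by linarith)
  have hc1 : c < 1 := (min_le_right _ _).trans_lt (by linarith [ht.2])
  obtain ⟨x, hx, hx2⟩ := exists_hasDerivAt_eq_slope d d1 htc hc.continuousOn (fun x _ => hd x)
  have hx3 : 0 < d1 x := hb2 ⟨hx.1, hx.2.trans hcb⟩
  rw [hx2, div_pos_iff_of_pos_right (by linarith)] at hx3
  have := hm c ⟨ht.1.trans htc.le, hc1.le⟩
  linarith

/-- Explicit periodic solution operator of `v' = a v + h` on `[0,1]`. -/
noncomputable def vdpP (a : ℝ) (h : ℝ → ℝ) (t : ℝ) : ℝ :=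
  Real.exp (a * t) * (Real.exp a * (∫ s in (0:ℝ)..1, Real.exp (-(a * s)) * h s) / (1 - Real.exp a)
    + ∫ s in (0:ℝ)..t, Real.exp (-(a * s)) * h s)

lemma vdpP_deriv (a : ℝ) {h : ℝ → ℝ} (hh : Continuous h) (t : ℝ) :
    HasDerivAt (vdpP a h) (a * vdpP a h t + h t) t := by
  have hc : Continuous fun s => Real.exp (-(a * s)) * h s := by fun_prop
  have h1 := hc.integral_hasStrictDerivAt 0 t |>.hasDerivAt
  have h2 : HasDerivAt (fun t : ℝ => Real.exp (a * t)) (Real.exp (a * t) * a) t := by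
    have := ((hasDerivAt_id t).const_mul a).exp
    simpa using this
  have h3 := h2.mul (h1.const_add
    (Real.exp a * (∫ s in (0:ℝ)..1, Real.exp (-(a * s)) * h s) / (1 - Real.exp a)))
  refine h3.congr_deriv ?_
  have h4 : Real.exp (a * t) * Real.exp (-(a * t)) = 1 := by
    rw [← Real.exp_add]; simp
  unfold vdpP
  linear_combination (h t) * h4

lemma vdpP_periodic {a : ℝ} (ha : a ≠ 0) (h : ℝ → ℝ) : vdpP a h 0 = vdpP a h 1 := by
  unfold vdpP
  have : 1 - Real.exp a ≠ 0 := by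
    intro h0
    have : Real.exp a = 1 := by linarith
    exact ha (by simpa using this)
  simp only [mul_zero, Real.exp_zero, mul_one, intervalIntegral.integral_same, one_mul, add_zero]
  field_simp
  ring

lemma vdp_first_bound {a : ℝ} (ha : a ≠ 0) {v h : ℝ → ℝ} {C : ℝ}
    (hv : ∀ t, HasDerivAt v (a * v t + h t) t) (h01 : v 0 = v 1)
    (hC : ∀ t ∈ Icc (0:ℝ) 1, |h t| ≤ C) : ∀ t ∈ Icc (0:ℝ) 1, |v t| ≤ C / |a| := by
  have key : ∀ (v h : ℝ → ℝ), (∀ t, HasDerivAt v (a * v t + h t) t) → v 0 = v 1 →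
      (∀ t ∈ Icc (0:ℝ) 1, |h t| ≤ C) → ∀ t ∈ Icc (0:ℝ) 1, v t ≤ C / |a| := by
    intro v h hv h01 hC
    rcases lt_or_gt_of_ne ha with hneg | hpos
    · refine vdp_max1' hv h01 fun t ht hlt => ?_
      rw [abs_of_neg hneg, div_lt_iff₀ (by linarith)] at hlt
      have := abs_le.1 (hC t ht)
      nlinarith
    · refine vdp_max1 hv h01 fun t ht hlt => ?_
      rw [abs_of_pos hpos, div_lt_iff₀ (by linarith)] at hlt
      have := abs_le.1 (hC t ht)
      nlinarith
  intro t ht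
  rw [abs_le]
  constructor
  · have := key (fun t => - v t) (fun t => - h t)
      (fun t => (hv t).neg.congr_deriv (by ring)) (by simp [h01])
      (fun t ht => by rw [abs_neg]; exact hC t ht) t ht
    linarith
  · exact key v h hv h01 hC t ht

lemma vdpP_diff {a : ℝ} (ha : a ≠ 0) {h k : ℝ → ℝ} (hh : Continuous h) (hk : Continuous k) {C : ℝ}
    (hC : ∀ t ∈ Icc (0:ℝ) 1, |h t - k t| ≤ C) :
    ∀ t ∈ Icc (0:ℝ) 1, |vdpP a h t - vdpP a k t| ≤ C / |a| :=
  vdp_first_bound ha (v := fun t => vdpP a h t - vdpP a k t) (h := fun t => h t - k t)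
    (fun t => ((vdpP_deriv a hh t).sub (vdpP_deriv a hk t)).congr_deriv (by ring))
    (by simp only [vdpP_periodic ha]) hC

lemma vdpP_cont (a : ℝ) {h : ℝ → ℝ} (hh : Continuous h) : Continuous (vdpP a h) :=
  continuous_iff_continuousAt.2 fun t => (vdpP_deriv a hh t).continuousAt

/-- `z` with first and second derivatives `z1`, `z2`, continuous, periodic boundary conditions. -/
structure VdpPer (z z1 z2 : ℝ → ℝ) : Prop where
  d1 : ∀ t, HasDerivAt z (z1 t) t
  d2 : ∀ t, HasDerivAt z1 (z2 t) t
  c2 : Continuous z2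
  p0 : z 0 = z 1
  p1 : z1 0 = z1 1

lemma VdpPer.c0 {z z1 z2 : ℝ → ℝ} (h : VdpPer z z1 z2) : Continuous z :=
  continuous_iff_continuousAt.2 fun t => (h.d1 t).continuousAt

lemma VdpPer.c1 {z z1 z2 : ℝ → ℝ} (h : VdpPer z z1 z2) : Continuous z1 :=
  continuous_iff_continuousAt.2 fun t => (h.d2 t).continuousAt

/-- Existence for the strongly damped scalar problem, by the contraction principle. -/
lemma vdp_scalar {F : ℝ → ℝ → ℝ → ℝ} {L m : ℝ} (hL : 0 ≤ L) (hm : 0 < m)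
    (hmL : L / m / m + 2 / m < 1)
    (hF : Continuous fun q : ℝ × ℝ × ℝ => F q.1 q.2.1 q.2.2)
    (hLip : ∀ t x p x' p', |F t x p - F t x' p'| ≤ L * |x - x'| + |p - p'|) :
    ∃ z z1 z2 : ℝ → ℝ, VdpPer z z1 z2 ∧
      ∀ t ∈ Icc (0:ℝ) 1, z2 t = F t (z t) (z1 t) + m ^ 2 * z t := by
  let E := C(Icc (0:ℝ) 1, ℝ)
  let V : E → ℝ → ℝ := fun v => IccExtend zero_le_one v
  have hV : ∀ v : E, Continuous (V v) := fun v => v.continuous.Icc_extend'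
  let Z : E → ℝ → ℝ := fun v => vdpP (-m) (V v)
  have hZ : ∀ v, Continuous (Z v) := fun v => vdpP_cont _ (hV v)
  let H : E → ℝ → ℝ := fun v t => F t (Z v t) (V v t - m * Z v t)
  have hH : ∀ v, Continuous (H v) := fun v => by
    have h1 := hZ v
    have h2 := hV v
    exact hF.comp (g := fun q : ℝ × ℝ × ℝ => F q.1 q.2.1 q.2.2)
      (f := fun t => (t, Z v t, V v t - m * Z v t)) (by fun_prop)
  let Φ : E → E := fun v => ⟨fun t => vdpP m (H v) t, (vdpP_cont m (hH v)).comp continuous_subtype_val⟩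
  have hm0 : m ≠ 0 := hm.ne'
  have hnm0 : -m ≠ 0 := neg_ne_zero.2 hm0
  have hdist : ∀ u v : E, dist (Φ u) (Φ v) ≤ (L / m / m + 2 / m) * dist u v := by
    intro u v
    rw [ContinuousMap.dist_le (by positivity)]
    have hVd : ∀ t ∈ Icc (0:ℝ) 1, |V u t - V v t| ≤ dist u v := fun t ht => by
      simp only [V, IccExtend_of_mem _ _ ht]
      exact ContinuousMap.dist_apply_le_dist (f := u) (g := v) ⟨t, ht⟩
    have hZd := vdpP_diff hnm0 (hV u) (hV v) hVd
    rw [abs_neg, abs_of_pos hm] at hZd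
    have hHd : ∀ t ∈ Icc (0:ℝ) 1, |H u t - H v t| ≤ (L / m + 2) * dist u v := by
      intro t ht
      have h1 : |Z u t - Z v t| ≤ dist u v / m := hZd t ht
      have h2 := hVd t ht
      refine (hLip _ _ _ _ _).trans ?_
      have h3 : |(V u t - m * Z u t) - (V v t - m * Z v t)| ≤ dist u v + m * (dist u v / m) := by
        have : (V u t - m * Z u t) - (V v t - m * Z v t)
          = (V u t - V v t) - m * (Z u t - Z v t) := by ring
        rw [this]
        refine (abs_sub _ _).trans ?_
        rw [abs_mul, abs_of_pos hm]
        gcongr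
      have h4 : L * |Z u t - Z v t| ≤ L * (dist u v / m) := by gcongr
      have h5 : m * (dist u v / m) = dist u v := by field_simp
      have h6 : L * (dist u v / m) = L / m * dist u v := by ring
      linarith
    intro t
    have := vdpP_diff hm0 (hH u) (hH v) hHd t t.2
    rw [abs_of_pos hm] at this
    refine this.trans (le_of_eq ?_)
    ring
  have hK : ContractingWith ⟨L / m / m + 2 / m, by positivity⟩ Φ :=
    ⟨by exact_mod_cast hmL, LipschitzWith.of_dist_le_mul hdist⟩
  set v := hK.fixedPoint with hvdef
  have hfix : Φ v = v := hK.fixedPoint_isFixedPt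
  let V1 := vdpP m (H v)
  have hV1c : Continuous V1 := vdpP_cont m (hH v)
  have hV1 : ∀ t ∈ Icc (0:ℝ) 1, V1 t = V v t := by
    intro t ht
    simp only [V, IccExtend_of_mem _ _ ht]
    rw [← hfix]
    rfl
  let Z1 := vdpP (-m) V1
  have hZ1 : ∀ t ∈ Icc (0:ℝ) 1, Z1 t = Z v t := by
    intro t ht
    have := vdpP_diff hnm0 hV1c (hV v) (C := 0) (fun t ht => by rw [hV1 t ht]; simp) t ht
    simp only [zero_div, abs_nonpos_iff] at this
    exact sub_eq_zero.1 this
  have hZ1c : Continuous Z1 := vdpP_cont _ hV1c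
  have hd1 : ∀ t, HasDerivAt Z1 (-m * Z1 t + V1 t) t := fun t => vdpP_deriv _ hV1c t
  have hHc := hH v
  refine ⟨Z1, fun t => -m * Z1 t + V1 t, fun t => m ^ 2 * Z1 t + H v t, ⟨hd1, ?_, ?_, ?_, ?_⟩, ?_⟩
  · intro t
    exact (((hd1 t).const_mul (-m)).add (vdpP_deriv m (hH v) t)).congr_deriv (by simp only [V1]; ring)
  · fun_prop
  · exact vdpP_periodic hnm0 _
  · simp only [Z1, V1, vdpP_periodic hnm0, vdpP_periodic hm0]
  · intro t ht
    simp only [H]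
    rw [← hZ1 t ht, ← hV1 t ht, add_comm, show V1 t - m * Z1 t = -m * Z1 t + V1 t by ring]

lemma vdp_gron_step {z1 z2 : ℝ → ℝ} {C δ a : ℝ} (hd : ∀ t, HasDerivAt z1 (z2 t) t)
    (hC : 0 ≤ C) (hδ : 0 ≤ δ) (hb : ∀ t ∈ Icc (0:ℝ) 1, |z2 t| ≤ |z1 t| + C)
    (ha : a ∈ Icc (0:ℝ) 1) (h0 : |z1 a| ≤ δ) :
    ∀ t ∈ Icc a 1, |z1 t| ≤ 2.72 * δ + 1.72 * C := by
  intro t ht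
  have hc : Continuous z1 := continuous_iff_continuousAt.2 fun t => (hd t).continuousAt
  have := norm_le_gronwallBound_of_norm_deriv_right_le (f := z1) (f' := z2) (δ := δ) (K := 1)
    (ε := C) (a := a) (b := 1) hc.continuousOn (fun x _ => (hd x).hasDerivWithinAt) h0
    (fun x hx => by
      have := hb x ⟨ha.1.trans hx.1, hx.2.le⟩
      simpa using this) t ht
  rw [gronwallBound_of_K_ne_0 one_ne_zero] at this
  simp only [one_mul, div_one, Real.norm_eq_abs] at this
  have he : Real.exp (t - a) ≤ 2.72 := by
    have h1 : Real.exp (t - a) ≤ Real.exp 1 := Real.exp_le_exp.2 (by linarith [ht.2, ha.1])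
    have := Real.exp_one_lt_d9
    linarith
  have h1 := mul_le_mul_of_nonneg_left he hδ
  have h2 := mul_le_mul_of_nonneg_left he hC
  linarith

lemma vdp_gron {z z1 z2 : ℝ → ℝ} {C : ℝ} (h : VdpPer z z1 z2) (hC : 0 ≤ C)
    (hb : ∀ t ∈ Icc (0:ℝ) 1, |z2 t| ≤ |z1 t| + C) : ∀ t ∈ Icc (0:ℝ) 1, |z1 t| ≤ 7 * C := by
  obtain ⟨a, ha, h0⟩ := exists_hasDerivAt_eq_zero zero_lt_one h.c0.continuousOn h.p0
    (fun x _ => h.d1 x)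
  have h1 := vdp_gron_step h.d2 hC le_rfl hb (a := a) ⟨ha.1.le, ha.2.le⟩ (by simp [h0])
    1 ⟨ha.2.le, le_rfl⟩
  rw [← h.p1] at h1
  intro t ht
  have h2 := vdp_gron_step h.d2 hC (by positivity) hb (a := 0) (by simp) h1 t ht
  linarith

/-- Structural hypotheses on the right hand sides. -/
structure VdpF (f : ℝ → ℝ → ℝ → ℝ → ℝ) (L : ℝ) : Prop where
  cont : Continuous fun q : ℝ × ℝ × ℝ × ℝ => f q.1 q.2.1 q.2.2.1 q.2.2.2
  lip : ∀ t x p w x' p' w',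
    |f t x p w - f t x' p' w'| ≤ L * |x - x'| + |p - p'| + L * |w - w'|
  anti : ∀ t x p w w', w ≤ w' → f t x p w' ≤ f t x p w

lemma vdp_compare {f : ℝ → ℝ → ℝ → ℝ → ℝ} {L m ε : ℝ} (hf : VdpF f L) (hL : 0 ≤ L)
    (hmL : 3 * L < m ^ 2) (hε : 0 ≤ ε)
    {u u1 u2 v v1 v2 ya yb wa wb : ℝ → ℝ}
    (hu : ∀ t, HasDerivAt u (u1 t) t) (hu1 : ∀ t, HasDerivAt u1 (u2 t) t)
    (hv : ∀ t, HasDerivAt v (v1 t) t) (hv1 : ∀ t, HasDerivAt v1 (v2 t) t)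
    (hup : u 0 = u 1) (hup1 : u1 1 ≤ u1 0) (hvp : v 0 = v 1) (hvp1 : v1 0 ≤ v1 1)
    (hus : ∀ t ∈ Icc (0:ℝ) 1, f t (u t) (u1 t) (wa t) + m ^ 2 * (u t - ya t) ≤ u2 t)
    (hvs : ∀ t ∈ Icc (0:ℝ) 1, v2 t ≤ f t (v t) (v1 t) (wb t) + m ^ 2 * (v t - yb t))
    (hy : ∀ t ∈ Icc (0:ℝ) 1, ya t ≤ yb t + ε) (hw : ∀ t ∈ Icc (0:ℝ) 1, wa t ≤ wb t + ε) :
    ∀ t ∈ Icc (0:ℝ) 1, u t ≤ v t + 2 * ε := by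
  have := vdp_max2 (d := fun t => u t - v t) (ε := 2 * ε)
    (fun t => (hu t).sub (hv t)) (fun t => (hu1 t).sub (hv1 t)) (by simp [hup, hvp])
    (by linarith) (by
      intro t ht hlt h0
      have e1 : u1 t = v1 t := by linarith
      have h1 := hus t ht
      have h2 := hvs t ht
      have h3 := hf.anti t (u t) (u1 t) _ _ (hw t ht)
      have h4 := (abs_le.1 (hf.lip t (u t) (u1 t) (wb t + ε) (v t) (v1 t) (wb t))).1
      rw [e1] at h4 h3 h1
      simp only [sub_self, abs_zero, add_sub_cancel_left, abs_of_nonneg hε] at h4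
      rw [abs_of_pos (by linarith : 0 < u t - v t)] at h4
      have h5 := mul_le_mul_of_nonneg_left (hy t ht) (sq_nonneg m)
      have h6 : 0 < (m ^ 2 - L) * (u t - v t - 2 * ε) :=
        mul_pos (by linarith) (by linarith)
      have h7 : 0 ≤ (m ^ 2 - 3 * L) * ε := mul_nonneg (by linarith) hε
      nlinarith)
  intro t ht
  have := this t ht
  linarith

lemma vdp_operator {f : ℝ → ℝ → ℝ → ℝ → ℝ} {L m : ℝ} (hf : VdpF f L) (hL : 0 ≤ L) (hm : 0 < m)
    (hmL : L / m / m + 2 / m < 1) :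
    ∃ T T1 T2 : C(ℝ, ℝ) → C(ℝ, ℝ) → C(ℝ, ℝ), ∀ y w, VdpPer (T y w) (T1 y w) (T2 y w) ∧
      ∀ t ∈ Icc (0:ℝ) 1,
        T2 y w t = f t (T y w t) (T1 y w t) (w t) + m ^ 2 * (T y w t - y t) := by
  have key : ∀ y w : C(ℝ, ℝ), ∃ z z1 z2 : C(ℝ, ℝ), VdpPer z z1 z2 ∧
      ∀ t ∈ Icc (0:ℝ) 1, z2 t = f t (z t) (z1 t) (w t) + m ^ 2 * (z t - y t) := by
    intro y w
    obtain ⟨z, z1, z2, hp, he⟩ := vdp_scalar (F := fun t x p => f t x p (w t) - m ^ 2 * y t)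
      hL hm hmL (by
        have := hf.cont.comp (f := fun q : ℝ × ℝ × ℝ => (q.1, q.2.1, q.2.2, w q.1)) (by fun_prop)
        exact this.sub (by fun_prop)) (by
        intro t x p x' p'
        have := hf.lip t x p (w t) x' p' (w t)
        simpa using this)
    refine ⟨⟨z, hp.c0⟩, ⟨z1, hp.c1⟩, ⟨z2, hp.c2⟩, hp, fun t ht => ?_⟩
    have := he t ht
    simp only [ContinuousMap.coe_mk]
    linarith
  choose T T1 T2 h using key
  exact ⟨T, T1, T2, h⟩

lemma vdp_limit {a : ℕ → C(ℝ, ℝ)} {β : ℝ → ℝ} {B : ℝ}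
    (hmono : ∀ n, ∀ t ∈ Icc (0:ℝ) 1, a n t ≤ a (n + 1) t)
    (hβ : ∀ n, ∀ t ∈ Icc (0:ℝ) 1, a n t ≤ β t)
    (hlip : ∀ n, ∀ s ∈ Icc (0:ℝ) 1, ∀ t ∈ Icc (0:ℝ) 1, |a n s - a n t| ≤ B * |s - t|) :
    ∃ l : C(ℝ, ℝ), (∀ ε > 0, ∃ n : ℕ, ∀ k ≥ n, ∀ t ∈ Icc (0:ℝ) 1, |a k t - l t| ≤ ε) ∧
      (∀ n, ∀ t ∈ Icc (0:ℝ) 1, a n t ≤ l t) ∧ ∀ t ∈ Icc (0:ℝ) 1, l t ≤ β t := by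
  have hm : ∀ t ∈ Icc (0:ℝ) 1, Monotone fun n => a n t := fun t ht =>
    monotone_nat_of_le_succ fun n => hmono n t ht
  have hbd : ∀ t ∈ Icc (0:ℝ) 1, BddAbove (range fun n => a n t) := fun t ht =>
    ⟨β t, by rintro _ ⟨n, rfl⟩; exact hβ n t ht⟩
  let g : ℝ → ℝ := fun t => ⨆ n, a n t
  have hg : ∀ t ∈ Icc (0:ℝ) 1, Tendsto (fun n => a n t) atTop (𝓝 (g t)) := fun t ht =>
    tendsto_atTop_ciSup (hm t ht) (hbd t ht)
  have hgl : ∀ s ∈ Icc (0:ℝ) 1, ∀ t ∈ Icc (0:ℝ) 1, |g s - g t| ≤ B * |s - t| := by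
    intro s hs t ht
    exact le_of_tendsto ((hg s hs).sub (hg t ht)).abs (Eventually.of_forall fun n => hlip n s hs t ht)
  have hgc : ContinuousOn g (Icc 0 1) := by
    have : LipschitzOnWith (Real.toNNReal B) g (Icc 0 1) := by
      refine LipschitzOnWith.of_dist_le_mul fun s hs t ht => ?_
      rw [Real.dist_eq, Real.dist_eq]
      refine (hgl s hs t ht).trans ?_
      gcongr
      exact Real.le_coe_toNNReal B
    exact this.continuousOn
  have hext : Continuous (IccExtend zero_le_one ((Icc (0:ℝ) 1).domRestrict g)) :=
    (continuousOn_iff_continuous_domRestrict.1 hgc).Icc_extend'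
  have hu := Monotone.tendstoUniformlyOn_of_forall_tendsto (F := fun n t => a n t) (f := g)
    (isCompact_Icc (a := (0:ℝ)) (b := 1)) (fun i => (a i).continuous.continuousOn) hm hgc hg
  let l : C(ℝ, ℝ) := ⟨_, hext⟩
  have heq : ∀ t ∈ Icc (0:ℝ) 1, l t = g t :=
    fun t ht => by
      change IccExtend zero_le_one ((Icc (0:ℝ) 1).domRestrict g) t = g t
      rw [IccExtend_of_mem _ _ ht]; rfl
  refine ⟨l, ?_, ?_, ?_⟩
  · intro ε hε
    obtain ⟨n, hn⟩ := eventually_atTop.1 (Metric.tendstoUniformlyOn_iff.1 hu ε hε)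
    refine ⟨n, fun k hk t ht => ?_⟩
    have := hn k hk t ht
    rw [heq t ht, abs_sub_comm]
    exact this.le
  · intro n t ht
    rw [heq t ht]
    exact le_ciSup (hbd t ht) n
  · intro t ht
    rw [heq t ht]
    exact ciSup_le fun n => hβ n t ht

/-- Ordered pair of lower and upper solution for one component. -/
structure VdpLow (f : ℝ → ℝ → ℝ → ℝ → ℝ) (a a1 a2 b : ℝ → ℝ) : Prop where
  d1 : ∀ t, HasDerivAt a (a1 t) t
  d2 : ∀ t, HasDerivAt a1 (a2 t) t
  p0 : a 0 = a 1
  p1 : a1 1 ≤ a1 0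
  le : ∀ t ∈ Icc (0:ℝ) 1, f t (a t) (a1 t) (b t) ≤ a2 t

structure VdpUpp (f : ℝ → ℝ → ℝ → ℝ → ℝ) (a a1 a2 b : ℝ → ℝ) : Prop where
  d1 : ∀ t, HasDerivAt a (a1 t) t
  d2 : ∀ t, HasDerivAt a1 (a2 t) t
  p0 : a 0 = a 1
  p1 : a1 0 ≤ a1 1
  le : ∀ t ∈ Icc (0:ℝ) 1, a2 t ≤ f t (a t) (a1 t) (b t)

/-- One component of the monotone iteration. -/
lemma vdp_component {f : ℝ → ℝ → ℝ → ℝ → ℝ} {L m R : ℝ} (hf : VdpF f L) (hL : 0 ≤ L) (hm : 0 < m)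
    (hmL : L / m / m + 2 / m < 1) (hmL' : 3 * L < m ^ 2) (hR : 0 ≤ R) (hf0 : ∀ t, |f t 0 0 0| ≤ R)
    {a a1 a2 b b1 b2 ao bo : ℝ → ℝ} (ha : VdpLow f a a1 a2 ao) (hb : VdpUpp f b b1 b2 bo)
    (haR : ∀ t ∈ Icc (0:ℝ) 1, -R ≤ a t) (hbR : ∀ t ∈ Icc (0:ℝ) 1, b t ≤ R)
    (haoR : ∀ t ∈ Icc (0:ℝ) 1, -R ≤ ao t) (hboR : ∀ t ∈ Icc (0:ℝ) 1, bo t ≤ R) :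
    ∃ T T1 T2 : C(ℝ, ℝ) → C(ℝ, ℝ) → C(ℝ, ℝ), ∃ B : ℝ,
      (∀ y w, VdpPer (T y w) (T1 y w) (T2 y w) ∧
      ∀ t ∈ Icc (0:ℝ) 1,
        T2 y w t = f t (T y w t) (T1 y w t) (w t) + m ^ 2 * (T y w t - y t)) ∧
      (∀ ε ≥ 0, ∀ y w y' w' : C(ℝ, ℝ), (∀ t ∈ Icc (0:ℝ) 1, y t ≤ y' t + ε) →
        (∀ t ∈ Icc (0:ℝ) 1, w t ≤ w' t + ε) →
        ∀ t ∈ Icc (0:ℝ) 1, T y w t ≤ T y' w' t + 2 * ε) ∧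
      (∀ y w : C(ℝ, ℝ), (∀ t ∈ Icc (0:ℝ) 1, a t ≤ y t) → (∀ t ∈ Icc (0:ℝ) 1, ao t ≤ w t) →
        ∀ t ∈ Icc (0:ℝ) 1, a t ≤ T y w t) ∧
      (∀ y w : C(ℝ, ℝ), (∀ t ∈ Icc (0:ℝ) 1, y t ≤ b t) → (∀ t ∈ Icc (0:ℝ) 1, w t ≤ bo t) →
        ∀ t ∈ Icc (0:ℝ) 1, T y w t ≤ b t) ∧
      (∀ y w : C(ℝ, ℝ), (∀ t ∈ Icc (0:ℝ) 1, a t ≤ y t) → (∀ t ∈ Icc (0:ℝ) 1, ao t ≤ w t) →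
        (∀ t ∈ Icc (0:ℝ) 1, y t ≤ b t) → (∀ t ∈ Icc (0:ℝ) 1, w t ≤ bo t) →
        ∀ s ∈ Icc (0:ℝ) 1, ∀ t ∈ Icc (0:ℝ) 1, |T y w s - T y w t| ≤ B * |s - t|) := by
  obtain ⟨T, T1, T2, hT⟩ := vdp_operator hf hL hm hmL
  have hlow : ∀ y w : C(ℝ, ℝ), (∀ t ∈ Icc (0:ℝ) 1, a t ≤ y t) →
      (∀ t ∈ Icc (0:ℝ) 1, ao t ≤ w t) → ∀ t ∈ Icc (0:ℝ) 1, a t ≤ T y w t := by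
    intro y w hy hw t ht
    have := vdp_compare hf hL hmL' le_rfl ha.d1 ha.d2 (hT y w).1.d1 (hT y w).1.d2 ha.p0 ha.p1
      (hT y w).1.p0 (hT y w).1.p1.le (ya := a) (wa := ao)
      (fun t ht => by simpa using ha.le t ht) (fun t ht => ((hT y w).2 t ht).le)
      (by simpa using hy) (by simpa using hw) t ht
    simpa using this
  have hupp : ∀ y w : C(ℝ, ℝ), (∀ t ∈ Icc (0:ℝ) 1, y t ≤ b t) →
      (∀ t ∈ Icc (0:ℝ) 1, w t ≤ bo t) → ∀ t ∈ Icc (0:ℝ) 1, T y w t ≤ b t := by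
    intro y w hy hw t ht
    have := vdp_compare hf hL hmL' le_rfl (hT y w).1.d1 (hT y w).1.d2 hb.d1 hb.d2
      (hT y w).1.p0 (hT y w).1.p1.ge hb.p0 hb.p1 (yb := b) (wb := bo)
      (fun t ht => ((hT y w).2 t ht).ge) (fun t ht => by simpa using hb.le t ht)
      (by simpa using hy) (by simpa using hw) t ht
    simpa using this
  refine ⟨T, T1, T2, 7 * (R + L * R + L * R + m ^ 2 * (2 * R)), hT, ?_, hlow, hupp, ?_⟩
  · intro ε hε y w y' w' hy hw
    exact vdp_compare hf hL hmL' hε (hT y w).1.d1 (hT y w).1.d2 (hT y' w').1.d1 (hT y' w').1.d2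
      (hT y w).1.p0 (hT y w).1.p1.ge (hT y' w').1.p0 (hT y' w').1.p1.le
      (fun t ht => ((hT y w).2 t ht).ge) (fun t ht => ((hT y' w').2 t ht).le) hy hw
  · intro y w h1 h2 h3 h4 s hs t ht
    have hder := vdp_gron (hT y w).1 (C := R + L * R + L * R + m ^ 2 * (2 * R)) (by positivity) (by
      intro t ht
      have e1 := hf.lip t (T y w t) (T1 y w t) (w t) 0 0 0
      simp only [sub_zero] at e1
      have e2 : |T y w t| ≤ R := abs_le.2 ⟨(haR t ht).trans (hlow y w h1 h2 t ht),
        (hupp y w h3 h4 t ht).trans (hbR t ht)⟩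
      have e3 : |y t| ≤ R := abs_le.2 ⟨(haR t ht).trans (h1 t ht), (h3 t ht).trans (hbR t ht)⟩
      have e4 : |w t| ≤ R := abs_le.2 ⟨(haoR t ht).trans (h2 t ht), (h4 t ht).trans (hboR t ht)⟩
      have e5 : |T y w t - y t| ≤ 2 * R := (abs_sub _ _).trans (by linarith)
      have e6 : |m ^ 2 * (T y w t - y t)| ≤ m ^ 2 * (2 * R) := by
        rw [abs_mul, abs_of_nonneg (sq_nonneg m)]; gcongr
      have e7 := mul_le_mul_of_nonneg_left e2 hL
      have e8 := mul_le_mul_of_nonneg_left e4 hL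
      have e9 := hf0 t
      rw [(hT y w).2 t ht]
      have e10 := abs_le.1 e1
      have e11 := abs_le.1 e6
      have e12 := abs_le.1 e9
      rw [abs_le]
      constructor <;> linarith)
    have := (convex_Icc (0:ℝ) 1).norm_image_sub_le_of_norm_hasDerivWithin_le (f := T y w)
      (fun x hx => ((hT y w).1.d1 x).hasDerivWithinAt) hder ht hs
    simpa using this

theorem vdp_system {f g : ℝ → ℝ → ℝ → ℝ → ℝ} {L R : ℝ} (hf : VdpF f L) (hg : VdpF g L)
    (hL : 0 ≤ L) (hR : 0 ≤ R) (hf0 : ∀ t, |f t 0 0 0| ≤ R) (hg0 : ∀ t, |g t 0 0 0| ≤ R)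
    {a a1 a2 b b1 b2 c c1 c2 e e1 e2 : ℝ → ℝ}
    (ha : VdpLow f a a1 a2 c) (hb : VdpUpp f b b1 b2 e)
    (hc : VdpLow g c c1 c2 a) (he : VdpUpp g e e1 e2 b)
    (haR : ∀ t ∈ Icc (0:ℝ) 1, -R ≤ a t) (hbR : ∀ t ∈ Icc (0:ℝ) 1, b t ≤ R)
    (hcR : ∀ t ∈ Icc (0:ℝ) 1, -R ≤ c t) (heR : ∀ t ∈ Icc (0:ℝ) 1, e t ≤ R)
    (hab : ∀ t ∈ Icc (0:ℝ) 1, a t ≤ b t) (hce : ∀ t ∈ Icc (0:ℝ) 1, c t ≤ e t) :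
    ∃ z z1 z2 w w1 w2 : ℝ → ℝ, VdpPer z z1 z2 ∧ VdpPer w w1 w2 ∧
      (∀ t ∈ Icc (0:ℝ) 1, z2 t = f t (z t) (z1 t) (w t)) ∧
      (∀ t ∈ Icc (0:ℝ) 1, w2 t = g t (w t) (w1 t) (z t)) ∧
      (∀ t ∈ Icc (0:ℝ) 1, a t ≤ z t ∧ z t ≤ b t ∧ c t ≤ w t ∧ w t ≤ e t) := by
  obtain ⟨m, hm, hmL, hmL'⟩ : ∃ m : ℝ, 0 < m ∧ L / m / m + 2 / m < 1 ∧ 3 * L < m ^ 2 := by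
    refine ⟨3 * L + 4, by positivity, ?_, by nlinarith⟩
    have h0 : (0:ℝ) < 3 * L + 4 := by positivity
    rw [div_div, div_add_div _ _ (by positivity) (by positivity), div_lt_one (by positivity)]
    nlinarith [mul_pos h0 h0, mul_nonneg hL h0.le, mul_nonneg hL (mul_pos h0 h0).le]
  have hac : Continuous a := continuous_iff_continuousAt.2 fun t => (ha.d1 t).continuousAt
  have hcc : Continuous c := continuous_iff_continuousAt.2 fun t => (hc.d1 t).continuousAt
  obtain ⟨T, T1, T2, B, hT, hTm, hTl, hTu, hTB⟩ :=
    vdp_component hf hL hm hmL hmL' hR hf0 ha hb haR hbR hcR heR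
  obtain ⟨S, S1, S2, D, hS, hSm, hSl, hSu, hSB⟩ :=
    vdp_component hg hL hm hmL hmL' hR hg0 hc he hcR heR haR hbR
  let step : C(ℝ, ℝ) × C(ℝ, ℝ) → C(ℝ, ℝ) × C(ℝ, ℝ) := fun p => (T p.1 p.2, S p.2 p.1)
  let p : ℕ → C(ℝ, ℝ) × C(ℝ, ℝ) := fun n => step^[n] (⟨a, hac⟩, ⟨c, hcc⟩)
  have hps : ∀ n, p (n + 1) = step (p n) := fun n => Function.iterate_succ_apply' _ _ _
  have hps1 : ∀ n, (p (n + 1)).1 = T (p n).1 (p n).2 := fun n => by rw [hps]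
  have hps2 : ∀ n, (p (n + 1)).2 = S (p n).2 (p n).1 := fun n => by rw [hps]
  have hQ : ∀ n, (∀ t ∈ Icc (0:ℝ) 1, a t ≤ (p n).1 t) ∧ (∀ t ∈ Icc (0:ℝ) 1, (p n).1 t ≤ b t) ∧
      (∀ t ∈ Icc (0:ℝ) 1, c t ≤ (p n).2 t) ∧ (∀ t ∈ Icc (0:ℝ) 1, (p n).2 t ≤ e t) := by
    intro n
    induction n with
    | zero => exact ⟨fun t ht => le_rfl, hab, fun t ht => le_rfl, hce⟩
    | succ n ih =>
      obtain ⟨i1, i2, i3, i4⟩ := ih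
      rw [hps1, hps2]
      exact ⟨hTl _ _ i1 i3, hTu _ _ i2 i4, hSl _ _ i3 i1, hSu _ _ i4 i2⟩
  have hM : ∀ n, (∀ t ∈ Icc (0:ℝ) 1, (p n).1 t ≤ (p (n+1)).1 t) ∧
      (∀ t ∈ Icc (0:ℝ) 1, (p n).2 t ≤ (p (n+1)).2 t) := by
    intro n
    induction n with
    | zero => exact ⟨(hQ 1).1, (hQ 1).2.2.1⟩
    | succ n ih =>
      rw [hps1 (n+1), hps2 (n+1), hps1 n, hps2 n]
      rw [← hps1 n, ← hps2 n]
      constructor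
      · intro t ht
        have := hTm 0 le_rfl (p n).1 (p n).2 (p (n+1)).1 (p (n+1)).2 (by simpa using ih.1)
          (by simpa using ih.2) t ht
        rw [← hps1] at this
        simpa using this
      · intro t ht
        have := hSm 0 le_rfl (p n).2 (p n).1 (p (n+1)).2 (p (n+1)).1 (by simpa using ih.2)
          (by simpa using ih.1) t ht
        rw [← hps2] at this
        simpa using this
  obtain ⟨l, hl1, hl2, hl3⟩ := vdp_limit (a := fun n => (p (n+1)).1) (β := b) (B := B)
    (fun n => (hM (n+1)).1) (fun n => (hQ (n+1)).2.1)
    (fun n => by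
      simp only [hps1]
      exact hTB _ _ (hQ n).1 (hQ n).2.2.1 (hQ n).2.1 (hQ n).2.2.2)
  obtain ⟨k, hk1, hk2, hk3⟩ := vdp_limit (a := fun n => (p (n+1)).2) (β := e) (B := D)
    (fun n => (hM (n+1)).2) (fun n => (hQ (n+1)).2.2.2)
    (fun n => by
      simp only [hps2]
      exact hSB _ _ (hQ n).2.2.1 (hQ n).1 (hQ n).2.2.2 (hQ n).2.1)
  have hconv : ∀ ε > 0, ∃ n : ℕ, (∀ t ∈ Icc (0:ℝ) 1, |(p n).1 t - l t| ≤ ε) ∧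
      (∀ t ∈ Icc (0:ℝ) 1, |(p n).2 t - k t| ≤ ε) ∧
      (∀ t ∈ Icc (0:ℝ) 1, |(p (n+1)).1 t - l t| ≤ ε) ∧
      (∀ t ∈ Icc (0:ℝ) 1, |(p (n+1)).2 t - k t| ≤ ε) := by
    intro ε hε
    obtain ⟨n1, h1⟩ := hl1 ε hε
    obtain ⟨n2, h2⟩ := hk1 ε hε
    refine ⟨max n1 n2 + 1, h1 _ (le_max_left _ _), h2 _ (le_max_right _ _),
      h1 _ ((le_max_left _ _).trans (Nat.le_succ _)), h2 _ ((le_max_right _ _).trans (Nat.le_succ _))⟩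
  have hTl' : ∀ t ∈ Icc (0:ℝ) 1, T l k t = l t := by
    intro t ht
    refine eq_of_forall_dist_le fun ε hε => ?_
    obtain ⟨n, h1, h2, h3, h4⟩ := hconv (ε / 3) (by positivity)
    have u1 := hTm (ε / 3) (by positivity) (p n).1 (p n).2 l k
      (fun t ht => by linarith [(abs_le.1 (h1 t ht)).2])
      (fun t ht => by linarith [(abs_le.1 (h2 t ht)).2]) t ht
    have u2 := hTm (ε / 3) (by positivity) l k (p n).1 (p n).2
      (fun t ht => by linarith [(abs_le.1 (h1 t ht)).1])
      (fun t ht => by linarith [(abs_le.1 (h2 t ht)).1]) t ht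
    have u3 := abs_le.1 (h3 t ht)
    rw [hps1] at u3
    rw [Real.dist_eq, abs_le]
    constructor <;> linarith [u3.1, u3.2]
  have hSk' : ∀ t ∈ Icc (0:ℝ) 1, S k l t = k t := by
    intro t ht
    refine eq_of_forall_dist_le fun ε hε => ?_
    obtain ⟨n, h1, h2, h3, h4⟩ := hconv (ε / 3) (by positivity)
    have u1 := hSm (ε / 3) (by positivity) (p n).2 (p n).1 k l
      (fun t ht => by linarith [(abs_le.1 (h2 t ht)).2])
      (fun t ht => by linarith [(abs_le.1 (h1 t ht)).2]) t ht
    have u2 := hSm (ε / 3) (by positivity) k l (p n).2 (p n).1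
      (fun t ht => by linarith [(abs_le.1 (h2 t ht)).1])
      (fun t ht => by linarith [(abs_le.1 (h1 t ht)).1]) t ht
    have u3 := abs_le.1 (h4 t ht)
    rw [hps2] at u3
    rw [Real.dist_eq, abs_le]
    constructor <;> linarith [u3.1, u3.2]
  refine ⟨T l k, T1 l k, T2 l k, S k l, S1 k l, S2 k l, (hT l k).1, (hS k l).1, ?_, ?_, ?_⟩
  · intro t ht
    rw [(hT l k).2 t ht, hTl' t ht, hSk' t ht]; ring
  · intro t ht
    rw [(hS k l).2 t ht, hTl' t ht, hSk' t ht]; ring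
  · intro t ht
    rw [hTl' t ht, hSk' t ht]
    exact ⟨((hQ 1).1 t ht).trans (hl2 0 t ht), hl3 t ht, ((hQ 1).2.2.1 t ht).trans (hk2 0 t ht),
      hk3 t ht⟩

/-- Cut-off to `[-M, M]`. -/
noncomputable def vdpCut (M x : ℝ) : ℝ := max (-M) (min x M)

lemma vdpCut_of_mem {M x : ℝ} (h : |x| ≤ M) : vdpCut M x = x := by
  have := abs_le.1 h
  unfold vdpCut
  rw [min_eq_left this.2, max_eq_right this.1]

lemma vdpCut_abs_le {M : ℝ} (hM : 0 ≤ M) (x : ℝ) : |vdpCut M x| ≤ M := by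
  unfold vdpCut
  rw [abs_le]
  exact ⟨le_max_left _ _, max_le (by linarith) (min_le_right _ _)⟩

lemma vdpCut_lip (M x y : ℝ) : |vdpCut M x - vdpCut M y| ≤ |x - y| := by
  unfold vdpCut
  refine (abs_max_sub_max_le_max _ _ _ _).trans ?_
  rw [sub_self, abs_zero]
  refine max_le (abs_nonneg _) ((abs_min_sub_min_le_max _ _ _ _).trans ?_)
  simp

lemma vdpCut_abs_le' {M : ℝ} (hM : 0 ≤ M) (x : ℝ) : |vdpCut M x| ≤ |x| := by
  have := vdpCut_lip M x 0
  rwa [vdpCut_of_mem (show |(0:ℝ)| ≤ M by simpa using hM), sub_zero, sub_zero] at this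

lemma vdpCut_cont (M : ℝ) : Continuous (vdpCut M) := by unfold vdpCut; fun_prop

/-- The truncated right hand side. -/
noncomputable def vdpRhs (A B C : ℝ) (φ r : ℝ → ℝ) (t x p w : ℝ) : ℝ :=
  vdpCut 112 p * (1 - 0.5 * (vdpCut 2 x) ^ 2) - x + A * φ (B * x - C * w) + r t

lemma vdp_half {k : ℝ} (h : |k| ≤ 2) : |1 - 0.5 * k ^ 2| ≤ 1 := by
  have := abs_le.1 h
  rw [abs_le]
  constructor <;> nlinarith

lemma vdpRhs_F {A B C : ℝ} {φ r : ℝ → ℝ} (hA : 0 ≤ A) (hB : 0 ≤ B) (hC : 0 ≤ C)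
    (hAB : A * B ≤ 25) (hAC : A * C ≤ 250) (hφ : Monotone φ) (hφc : Continuous φ)
    (hφl : ∀ x y, |φ x - φ y| ≤ |x - y|) (hr : Continuous r) : VdpF (vdpRhs A B C φ r) 250 := by
  refine ⟨?_, ?_, ?_⟩
  · have h1 := vdpCut_cont 112
    have h2 := vdpCut_cont 2
    unfold vdpRhs
    fun_prop
  · intro t x p w x' p' w'
    have e1 := vdpCut_lip 112 p p'
    have e2 := vdpCut_lip 2 x x'
    have e3 := vdpCut_abs_le (by norm_num : (0:ℝ) ≤ 2) x
    have e4 := vdpCut_abs_le (by norm_num : (0:ℝ) ≤ 2) x'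
    have e5 := vdpCut_abs_le (by norm_num : (0:ℝ) ≤ 112) p'
    have e6 := hφl (B * x - C * w) (B * x' - C * w')
    unfold vdpRhs
    set P := vdpCut 112 p
    set P' := vdpCut 112 p'
    set X := vdpCut 2 x
    set X' := vdpCut 2 x'
    have hdec : P * (1 - 0.5 * X ^ 2) - x + A * φ (B * x - C * w) + r t
      - (P' * (1 - 0.5 * X' ^ 2) - x' + A * φ (B * x' - C * w') + r t)
      = (P - P') * (1 - 0.5 * X ^ 2) + P' * (0.5 * (X' + X)) * (X' - X) - (x - x')
        + A * (φ (B * x - C * w) - φ (B * x' - C * w')) := by ring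
    have f1 : |(P - P') * (1 - 0.5 * X ^ 2)| ≤ |p - p'| := by
      rw [abs_mul]
      have := mul_le_mul e1 (vdp_half e3) (abs_nonneg _) (abs_nonneg _)
      linarith
    have f2 : |P' * (0.5 * (X' + X)) * (X' - X)| ≤ 112 * 2 * |x - x'| := by
      rw [abs_mul, abs_mul, abs_sub_comm X' X]
      have : |0.5 * (X' + X)| ≤ 2 := by
        have := abs_le.1 e3
        have := abs_le.1 e4
        rw [abs_le]; constructor <;> linarith
      gcongr
    have f3 : |A * (φ (B * x - C * w) - φ (B * x' - C * w'))| ≤ 25 * |x - x'| + 250 * |w - w'| := by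
      rw [abs_mul, abs_of_nonneg hA]
      have g1 : |B * x - C * w - (B * x' - C * w')| ≤ B * |x - x'| + C * |w - w'| := by
        have : B * x - C * w - (B * x' - C * w') = B * (x - x') - C * (w - w') := by ring
        rw [this]
        refine (abs_sub _ _).trans ?_
        rw [abs_mul, abs_mul, abs_of_nonneg hB, abs_of_nonneg hC]
      have g2 := mul_le_mul_of_nonneg_left (e6.trans g1) hA
      have g3 := mul_le_mul_of_nonneg_right hAB (abs_nonneg (x - x'))
      have g4 := mul_le_mul_of_nonneg_right hAC (abs_nonneg (w - w'))
      linarith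
    rw [hdec]
    have k1 := abs_add_le ((P - P') * (1 - 0.5 * X ^ 2) + P' * (0.5 * (X' + X)) * (X' - X) - (x - x'))
      (A * (φ (B * x - C * w) - φ (B * x' - C * w')))
    have k2 := abs_sub ((P - P') * (1 - 0.5 * X ^ 2) + P' * (0.5 * (X' + X)) * (X' - X)) (x - x')
    have k3 := abs_add_le ((P - P') * (1 - 0.5 * X ^ 2)) (P' * (0.5 * (X' + X)) * (X' - X))
    linarith [abs_nonneg (x - x'), abs_nonneg (w - w')]
  · intro t x p w w' hw
    unfold vdpRhs
    have : φ (B * x - C * w') ≤ φ (B * x - C * w) := hφ (by nlinarith)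
    nlinarith

lemma vdpRhs_bound {A B C K : ℝ} {φ r : ℝ → ℝ} (hK : ∀ t s, |A * φ s + r t| ≤ K)
    (t x p w : ℝ) (hx : |x| ≤ 2) : |vdpRhs A B C φ r t x p w| ≤ |p| + (2 + K) := by
  unfold vdpRhs
  rw [vdpCut_of_mem hx]
  have e1 := vdpCut_abs_le' (by norm_num : (0:ℝ) ≤ 112) p
  have f1 : |vdpCut 112 p * (1 - 0.5 * x ^ 2)| ≤ |p| := by
    rw [abs_mul]
    have := mul_le_mul e1 (vdp_half hx) (abs_nonneg _) (abs_nonneg _)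
    linarith
  have e2 := abs_le.1 (hK t (B * x - C * w))
  have e3 := abs_le.1 f1
  have e4 := abs_le.1 hx
  rw [abs_le]
  constructor <;> linarith

lemma vdp_tanh_deriv (x : ℝ) : HasDerivAt Real.tanh (1 / Real.cosh x ^ 2) x := by
  have h := (Real.hasDerivAt_sinh x).div (Real.hasDerivAt_cosh x) (Real.cosh_pos x).ne'
  have e : Real.tanh = Real.sinh / Real.cosh := by
    funext y; simp [Real.tanh_eq_sinh_div_cosh]
  rw [e]
  refine h.congr_deriv ?_
  rw [← Real.cosh_sq_sub_sinh_sq x]; ring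

lemma vdp_lip_of_deriv {φ φ' : ℝ → ℝ} (h : ∀ x, HasDerivAt φ (φ' x) x) (hb : ∀ x, |φ' x| ≤ 1)
    (x y : ℝ) : |φ x - φ y| ≤ |x - y| := by
  have := convex_univ.norm_image_sub_le_of_norm_hasDerivWithin_le (f := φ) (C := 1)
    (fun x _ => (h x).hasDerivWithinAt) (fun x _ => hb x) (mem_univ y) (mem_univ x)
  simpa using this

lemma vdp_tanh_lip (x y : ℝ) : |Real.tanh x - Real.tanh y| ≤ |x - y| := by
  refine vdp_lip_of_deriv vdp_tanh_deriv (fun x => ?_) x y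
  have := Real.one_le_cosh x
  rw [abs_of_nonneg (by positivity)]
  exact div_le_one_of_le₀ (by nlinarith) (by positivity)

lemma vdp_tanh_mono : Monotone Real.tanh :=
  monotone_of_deriv_nonneg (fun x => (vdp_tanh_deriv x).differentiableAt) fun x => by
    rw [(vdp_tanh_deriv x).deriv]; positivity

lemma vdp_arctan_lip (x y : ℝ) : |Real.arctan x - Real.arctan y| ≤ |x - y| := by
  refine vdp_lip_of_deriv Real.hasDerivAt_arctan (fun x => ?_) x y
  rw [abs_of_nonneg (by positivity)]
  exact div_le_one_of_le₀ (by nlinarith [sq_nonneg x]) (by positivity)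

lemma vdp_tanh_32 : 0.9 ≤ Real.tanh (3 / 2) := by
  rw [Real.tanh_eq_sinh_div_cosh, le_div_iff₀ (Real.cosh_pos _), Real.sinh_eq, Real.cosh_eq]
  have h1 : Real.exp (3/2) * Real.exp (-(3/2)) = 1 := by rw [← Real.exp_add]; simp
  have h2 : Real.exp (3/2) ^ 2 = Real.exp 1 ^ 3 := by
    rw [← Real.exp_nat_mul, ← Real.exp_nat_mul]; norm_num
  have h3 := Real.exp_one_gt_d9
  have h4 : (2.7:ℝ) ^ 3 ≤ Real.exp 1 ^ 3 := by gcongr; linarith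
  have h5 := Real.exp_pos (-(3/2))
  have h6 : 19 * Real.exp (-(3/2)) ≤ Real.exp (3/2) := by
    have : 19 ≤ Real.exp (3/2) ^ 2 := by rw [h2]; exact le_trans (by norm_num) h4
    nlinarith
  linarith

lemma vdp_arctan_half : 0.45 ≤ Real.arctan (1 / 2) := by
  have h1 := Real.arctan_inv_2_add_arctan_inv_3
  have h2 := (abs_le.1 (vdp_arctan_lip 3⁻¹ 0)).2
  rw [Real.arctan_zero, sub_zero, sub_zero, abs_of_pos (by norm_num)] at h2
  have := Real.pi_gt_d2
  norm_num at *
  linarith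

lemma vdp_arctan_169 : 1 ≤ Real.arctan (16 / 9) := by
  have h1 := Real.arctan_inv_of_pos (x := 16 / 9) (by norm_num)
  have h2 := (abs_le.1 (vdp_arctan_lip (16/9)⁻¹ 0)).2
  rw [Real.arctan_zero, sub_zero, sub_zero, abs_of_pos (by norm_num)] at h2
  have := Real.pi_gt_d4
  norm_num at *
  linarith

lemma vdp_contDiff {z z1 z2 : ℝ → ℝ} (h : VdpPer z z1 z2) :
    ContDiff ℝ 2 z ∧ deriv z = z1 ∧ deriv (deriv z) = z2 := by
  have e1 : deriv z = z1 := funext fun t => (h.d1 t).deriv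
  have e2 : deriv z1 = z2 := funext fun t => (h.d2 t).deriv
  refine ⟨?_, e1, by rw [e1, e2]⟩
  rw [show (2 : WithTop ℕ∞) = 1 + 1 from one_add_one_eq_two.symm, contDiff_succ_iff_deriv]
  refine ⟨fun t => (h.d1 t).differentiableAt, by simp, ?_⟩
  rw [e1, contDiff_one_iff_deriv]
  exact ⟨fun t => (h.d2 t).differentiableAt, by rw [e2]; exact h.c2⟩

lemma vdp_q_bounds {t : ℝ} (ht : t ∈ Icc (0:ℝ) 1) : 0 ≤ t - t ^ 2 ∧ t - t ^ 2 ≤ 1 / 4 := by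
  obtain ⟨h0, h1⟩ := ht
  constructor <;> nlinarith [sq_nonneg (t - 1 / 2)]

lemma vdp_r_bounds {t : ℝ} (ht : t ∈ Icc (0:ℝ) 1) :
    0 ≤ t ^ 2 - t ^ 3 ∧ t ^ 2 - t ^ 3 ≤ 4 / 27 := by
  obtain ⟨h0, h1⟩ := ht
  constructor
  · nlinarith [mul_nonneg (sq_nonneg t) (sub_nonneg.2 h1)]
  · nlinarith [mul_nonneg (sq_nonneg (t - 2 / 3)) (by linarith : 0 ≤ t + 1 / 3)]

noncomputable abbrev vdpf := vdpRhs 6 3 2 Real.tanh Real.cos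
noncomputable abbrev vdpg := vdpRhs 8 2 1 Real.arctan (fun t => - Real.cos t)

lemma vdp_cos_nonneg {t : ℝ} (ht : t ∈ Icc (0:ℝ) 1) : 0.5 ≤ Real.cos t := by
  have := Real.one_sub_sq_div_two_le_cos (x := t)
  nlinarith [ht.1, ht.2]

lemma vdp_lowf : VdpLow vdpf (fun t => -5 / 4 + t - t ^ 2) (fun t => 1 - 2 * t) (fun _ => -2)
    (fun t => -1 + t - t ^ 2) := by
  refine ⟨fun t => ?_, fun t => ?_, by norm_num, by norm_num, fun t ht => ?_⟩
  · refine (((hasDerivAt_id t).const_add (-5/4)).sub (hasDerivAt_pow 2 t)).congr_deriv ?_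
    simp
  · refine (((hasDerivAt_id t).const_mul 2).const_sub 1).congr_deriv ?_
    simp
  · obtain ⟨q0, q1⟩ := vdp_q_bounds ht
    have hx : |(-5/4 + t - t^2)| ≤ 2 := by rw [abs_le]; constructor <;> linarith
    have hp' : |1 - 2 * t| ≤ 1 := by rw [abs_le]; constructor <;> linarith [ht.1, ht.2]
    have hp : |1 - 2 * t| ≤ 112 := by linarith
    simp only [vdpf, vdpRhs, vdpCut_of_mem hx, vdpCut_of_mem hp]
    have h1 : Real.tanh (3 * (-5/4 + t - t^2) - 2 * (-1 + t - t^2)) ≤ -0.9 := by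
      have := vdp_tanh_mono (show 3 * (-5/4 + t - t^2) - 2 * (-1 + t - t^2) ≤ -(3/2) by linarith)
      rw [Real.tanh_neg] at this
      linarith [vdp_tanh_32]
    have h2 := Real.cos_le_one t
    have h3 : (1 - 2 * t) * (1 - 0.5 * (-5/4 + t - t^2)^2) ≤ 0.5 := by
      have k1 : 1 - 0.5 * (-5/4 + t - t^2)^2 ≤ 0.5 := by nlinarith
      have k2 : 0 ≤ 1 - 0.5 * (-5/4 + t - t^2)^2 := by nlinarith
      nlinarith [abs_le.1 hp']
    linarith

lemma vdp_lowg : VdpLow vdpg (fun t => -1 + t - t ^ 2) (fun t => 1 - 2 * t) (fun _ => -2)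
    (fun t => -5 / 4 + t - t ^ 2) := by
  refine ⟨fun t => ?_, fun t => ?_, by norm_num, by norm_num, fun t ht => ?_⟩
  · refine (((hasDerivAt_id t).const_add (-1)).sub (hasDerivAt_pow 2 t)).congr_deriv ?_
    simp
  · refine (((hasDerivAt_id t).const_mul 2).const_sub 1).congr_deriv ?_
    simp
  · obtain ⟨q0, q1⟩ := vdp_q_bounds ht
    have hx : |(-1 + t - t^2)| ≤ 2 := by rw [abs_le]; constructor <;> linarith
    have hp' : |1 - 2 * t| ≤ 1 := by rw [abs_le]; constructor <;> linarith [ht.1, ht.2]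
    have hp : |1 - 2 * t| ≤ 112 := by linarith
    simp only [vdpg, vdpRhs, vdpCut_of_mem hx, vdpCut_of_mem hp]
    have h1 : Real.arctan (2 * (-1 + t - t^2) - 1 * (-5/4 + t - t^2)) ≤ -0.45 := by
      have := Real.arctan_mono
        (show 2 * (-1 + t - t^2) - 1 * (-5/4 + t - t^2) ≤ -(1/2) by linarith)
      rw [Real.arctan_neg] at this
      linarith [vdp_arctan_half]
    have h2 := vdp_cos_nonneg ht
    have h3 : (1 - 2 * t) * (1 - 0.5 * (-1 + t - t^2)^2) ≤ 0.75 := by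
      have k1 : 1 - 0.5 * (-1 + t - t^2)^2 ≤ 0.75 := by nlinarith
      have k2 : 0 ≤ 1 - 0.5 * (-1 + t - t^2)^2 := by nlinarith
      nlinarith [abs_le.1 hp']
    linarith

lemma vdp_uppf : VdpUpp vdpf (fun t => 2 - t ^ 2 / 2 + t ^ 3 / 2) (fun t => -t + 3 / 2 * t ^ 2)
    (fun t => -1 + 3 * t) (fun t => 2 - t ^ 2 + t ^ 3) := by
  refine ⟨fun t => ?_, fun t => ?_, by norm_num, by norm_num, fun t ht => ?_⟩
  · refine ((((hasDerivAt_pow 2 t).div_const 2).const_sub 2).add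
      ((hasDerivAt_pow 3 t).div_const 2)).congr_deriv ?_
    norm_num; ring
  · refine ((hasDerivAt_id t).neg.add ((hasDerivAt_pow 2 t).const_mul (3/2))).congr_deriv ?_
    norm_num; ring
  · obtain ⟨r0, r1⟩ := vdp_r_bounds ht
    obtain ⟨t0, t1⟩ := ht
    have hx : |2 - t ^ 2 / 2 + t ^ 3 / 2| ≤ 2 := by rw [abs_le]; constructor <;> linarith
    have hp1 : -(1/6) ≤ -t + 3 / 2 * t ^ 2 := by nlinarith [sq_nonneg (t - 1/3)]
    have hp2 : -t + 3 / 2 * t ^ 2 ≤ 1/2 := by nlinarith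
    have hp : |-t + 3 / 2 * t ^ 2| ≤ 112 := by rw [abs_le]; constructor <;> linarith
    simp only [vdpf, vdpRhs, vdpCut_of_mem hx, vdpCut_of_mem hp]
    have h1 : 0.9 ≤ Real.tanh (3 * (2 - t ^ 2 / 2 + t ^ 3 / 2) - 2 * (2 - t ^ 2 + t ^ 3)) :=
      vdp_tanh_32.trans (vdp_tanh_mono (by linarith))
    have h2 := vdp_cos_nonneg ⟨t0, t1⟩
    have h3 : -0.5 ≤ (-t + 3 / 2 * t ^ 2) * (1 - 0.5 * (2 - t ^ 2 / 2 + t ^ 3 / 2)^2) := by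
      have k1 : 1 - 0.5 * (2 - t ^ 2 / 2 + t ^ 3 / 2)^2 ≤ 0 := by nlinarith
      have k2 := (abs_le.1 (vdp_half hx)).1
      nlinarith
    linarith

lemma vdp_uppg : VdpUpp vdpg (fun t => 2 - t ^ 2 + t ^ 3) (fun t => -2 * t + 3 * t ^ 2)
    (fun t => -2 + 6 * t) (fun t => 2 - t ^ 2 / 2 + t ^ 3 / 2) := by
  refine ⟨fun t => ?_, fun t => ?_, by norm_num, by norm_num, fun t ht => ?_⟩
  · refine (((hasDerivAt_pow 2 t).const_sub 2).add (hasDerivAt_pow 3 t)).congr_deriv ?_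
    norm_num
  · refine (((hasDerivAt_id t).const_mul (-2)).add ((hasDerivAt_pow 2 t).const_mul 3)).congr_deriv ?_
    norm_num; ring
  · obtain ⟨r0, r1⟩ := vdp_r_bounds ht
    obtain ⟨t0, t1⟩ := ht
    have hx : |2 - t ^ 2 + t ^ 3| ≤ 2 := by rw [abs_le]; constructor <;> linarith
    have hp1 : -(1/3) ≤ -2 * t + 3 * t ^ 2 := by nlinarith [sq_nonneg (t - 1/3)]
    have hp2 : -2 * t + 3 * t ^ 2 ≤ 1 := by nlinarith
    have hp : |-2 * t + 3 * t ^ 2| ≤ 112 := by rw [abs_le]; constructor <;> linarith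
    simp only [vdpg, vdpRhs, vdpCut_of_mem hx, vdpCut_of_mem hp]
    have h1 : 1 ≤ Real.arctan (2 * (2 - t ^ 2 + t ^ 3) - 1 * (2 - t ^ 2 / 2 + t ^ 3 / 2)) :=
      vdp_arctan_169.trans (Real.arctan_mono (by linarith))
    have h2 := Real.cos_le_one t
    have h3 : -1 ≤ (-2 * t + 3 * t ^ 2) * (1 - 0.5 * (2 - t ^ 2 + t ^ 3)^2) := by
      have k1 : 1 - 0.5 * (2 - t ^ 2 + t ^ 3)^2 ≤ 0 := by nlinarith
      have k2 := (abs_le.1 (vdp_half hx)).1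
      nlinarith
    linarith

lemma vdp_boundf (t s : ℝ) : |6 * Real.tanh s + Real.cos t| ≤ 14 := by
  have h1 := Real.tanh_lt_one s
  have h2 := Real.neg_one_lt_tanh s
  have h3 := Real.cos_le_one t
  have h4 := Real.neg_one_le_cos t
  rw [abs_le]; constructor <;> linarith

lemma vdp_boundg (t s : ℝ) : |8 * Real.arctan s + - Real.cos t| ≤ 14 := by
  have h1 := Real.arctan_lt_pi_div_two s
  have h2 := Real.neg_pi_div_two_lt_arctan s
  have h3 := Real.cos_le_one t
  have h4 := Real.neg_one_le_cos t
  have h5 := Real.pi_lt_d2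
  rw [abs_le]; constructor <;> linarith

/-- Removing the truncation. -/
lemma vdp_untruncate {A B C : ℝ} {φ r : ℝ → ℝ} (hK : ∀ t s, |A * φ s + r t| ≤ 14)
    {z z1 z2 w : ℝ → ℝ} (h : VdpPer z z1 z2) (hz : ∀ t ∈ Icc (0:ℝ) 1, |z t| ≤ 2)
    (he : ∀ t ∈ Icc (0:ℝ) 1, z2 t = vdpRhs A B C φ r t (z t) (z1 t) (w t)) :
    ∀ t ∈ Icc (0:ℝ) 1,
      z2 t = z1 t * (1 - 0.5 * z t ^ 2) - z t + A * φ (B * z t - C * w t) + r t := by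
  have hb := vdp_gron h (C := 16) (by norm_num) (fun t ht => by
    rw [he t ht]
    have := vdpRhs_bound (B := B) (C := C) hK t (z t) (z1 t) (w t) (hz t ht)
    linarith)
  intro t ht
  have h1 := hb t ht
  rw [he t ht, vdpRhs, vdpCut_of_mem (hz t ht), vdpCut_of_mem (by linarith)]

lemma vdp_const_deriv2 {z : ℝ → ℝ} {c : ℝ} (h : ∀ t ∈ Icc (0:ℝ) 1, z t = c) :
    ∀ t ∈ Ioo (0:ℝ) 1, deriv z t = 0 ∧ deriv (deriv z) t = 0 := by
  have h1 : ∀ t ∈ Ioo (0:ℝ) 1, deriv z t = 0 := by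
    intro t ht
    have : z =ᶠ[𝓝 t] fun _ => c := by
      filter_upwards [Ioo_mem_nhds ht.1 ht.2] with s hs
      exact h s ⟨hs.1.le, hs.2.le⟩
    rw [this.deriv_eq]; simp
  intro t ht
  refine ⟨h1 t ht, ?_⟩
  have : deriv z =ᶠ[𝓝 t] fun _ => 0 := by
    filter_upwards [Ioo_mem_nhds ht.1 ht.2] with s hs
    exact h1 s hs
  rw [this.deriv_eq]; simp

/-- The coupled forced Van der Pol system on `[0,1]` with periodic boundary
conditions has at least one solution `(z, w) ∈ (C²[0,1])²`, localized between
the shifted lower and upper solutions; moreover this solution is non-trivial,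
i.e. not a pair of constant functions on `[0,1]`. -/
theorem stmt_14 :
    ∃ z w : ℝ → ℝ, ContDiff ℝ 2 z ∧ ContDiff ℝ 2 w ∧
      (∀ t ∈ Set.Icc (0:ℝ) 1,
        deriv (deriv z) t =
          deriv z t * (1 - 0.5 * (z t) ^ 2) - z t
            + 6 * Real.tanh (3 * z t - 2 * w t) + Real.cos t) ∧
      (∀ t ∈ Set.Icc (0:ℝ) 1,
        deriv (deriv w) t =
          deriv w t * (1 - 0.5 * (w t) ^ 2) - w t
            + 8 * Real.arctan (2 * w t - z t) - Real.cos t) ∧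
      z 0 = z 1 ∧ deriv z 0 = deriv z 1 ∧ w 0 = w 1 ∧ deriv w 0 = deriv w 1 ∧
      (∀ t ∈ Set.Icc (0:ℝ) 1,
        -5 / 4 + t - t ^ 2 ≤ z t ∧ z t ≤ 2 - t ^ 2 / 2 + t ^ 3 / 2 ∧
        -1 + t - t ^ 2 ≤ w t ∧ w t ≤ 2 - t ^ 2 + t ^ 3) ∧
      ¬ (∃ c₁ c₂ : ℝ, (∀ t ∈ Set.Icc (0:ℝ) 1, z t = c₁) ∧
          (∀ t ∈ Set.Icc (0:ℝ) 1, w t = c₂)) := by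
  obtain ⟨z, z1, z2, w, w1, w2, hz, hw, ez, ew, hb⟩ := vdp_system (R := 2)
    (vdpRhs_F (A := 6) (B := 3) (C := 2) (φ := Real.tanh) (r := Real.cos) (by norm_num)
      (by norm_num) (by norm_num) (by norm_num) (by norm_num) vdp_tanh_mono
      (continuous_iff_continuousAt.2 fun x => (vdp_tanh_deriv x).continuousAt) vdp_tanh_lip
      Real.continuous_cos)
    (vdpRhs_F (A := 8) (B := 2) (C := 1) (φ := Real.arctan) (r := fun t => - Real.cos t)
      (by norm_num) (by norm_num) (by norm_num) (by norm_num) (by norm_num) Real.arctan_mono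
      Real.continuous_arctan vdp_arctan_lip Real.continuous_cos.neg)
    (by norm_num) (by norm_num)
    (fun t => by
      have := Real.abs_cos_le_one t
      simp [vdpRhs, vdpCut]; linarith)
    (fun t => by
      have := Real.abs_cos_le_one t
      simp [vdpRhs, vdpCut]; linarith)
    vdp_lowf vdp_uppf vdp_lowg vdp_uppg
    (fun t ht => by linarith [vdp_q_bounds ht]) (fun t ht => by linarith [vdp_r_bounds ht])
    (fun t ht => by linarith [vdp_q_bounds ht]) (fun t ht => by linarith [vdp_r_bounds ht])
    (fun t ht => by linarith [vdp_q_bounds ht, vdp_r_bounds ht])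
    (fun t ht => by linarith [vdp_q_bounds ht, vdp_r_bounds ht])
  have hz2 : ∀ t ∈ Icc (0:ℝ) 1, |z t| ≤ 2 := fun t ht => by
    have := hb t ht
    have := vdp_q_bounds ht
    have := vdp_r_bounds ht
    rw [abs_le]; constructor <;> linarith
  have hw2 : ∀ t ∈ Icc (0:ℝ) 1, |w t| ≤ 2 := fun t ht => by
    have := hb t ht
    have := vdp_q_bounds ht
    have := vdp_r_bounds ht
    rw [abs_le]; constructor <;> linarith
  have ez' := vdp_untruncate vdp_boundf hz hz2 ez
  have ew' := vdp_untruncate vdp_boundg hw hw2 ew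
  obtain ⟨cz, dz, ddz⟩ := vdp_contDiff hz
  obtain ⟨cw, dw, ddw⟩ := vdp_contDiff hw
  have Ez : ∀ t ∈ Set.Icc (0:ℝ) 1, deriv (deriv z) t =
      deriv z t * (1 - 0.5 * (z t) ^ 2) - z t + 6 * Real.tanh (3 * z t - 2 * w t) + Real.cos t := by
    intro t ht
    rw [ddz, dz]; exact ez' t ht
  have Ew : ∀ t ∈ Set.Icc (0:ℝ) 1, deriv (deriv w) t =
      deriv w t * (1 - 0.5 * (w t) ^ 2) - w t + 8 * Real.arctan (2 * w t - z t) - Real.cos t := by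
    intro t ht
    rw [ddw, dw, ew' t ht, one_mul, ← sub_eq_add_neg]
  refine ⟨z, w, cz, cw, Ez, Ew, hz.p0, by rw [dz]; exact hz.p1, hw.p0, by rw [dw]; exact hw.p1,
    hb, ?_⟩
  rintro ⟨c₁, c₂, h1, h2⟩
  have key : ∀ t ∈ Ioo (0:ℝ) 1, Real.cos t = c₁ - 6 * Real.tanh (3 * c₁ - 2 * c₂) := by
    intro t ht
    have ht' : t ∈ Icc (0:ℝ) 1 := ⟨ht.1.le, ht.2.le⟩
    have := Ez t ht'
    obtain ⟨k1, k2⟩ := vdp_const_deriv2 h1 t ht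
    rw [k2, k1, h1 t ht', h2 t ht'] at this
    linarith
  have e := (key (1/4) (by constructor <;> norm_num)).trans
    (key (1/2) (by constructor <;> norm_num)).symm
  have hpi := Real.pi_gt_three
  have := Real.injOn_cos (show (1/4:ℝ) ∈ Icc 0 Real.pi by constructor <;> linarith)
    (show (1/2:ℝ) ∈ Icc 0 Real.pi by constructor <;> linarith) e
  norm_num at this
end
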